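/- Let Λ be a quasi-lacunary and subgeometric sequence, let α > 0, 0 < β < 1 and p ≥ 1, and let μ be a positive Borel measure on [0,1]. Then the following are equivalent: (i) there is a constant C such that ‖f‖_{L^p(dμ)} ≤ C ‖f‖_{L^{p/β}(dν_{α−1})} for all f ∈ M_Λ; (ii) ∑_{k≥0} λ_{n_k}^{αβ/(1−β)} (∫_{[0,1]} t^{p λ_{n_k}} dμ(t))^{1/(1−β)} < ∞. -/

import Mathlib

open MeasureTheory Set Filter

/-- The weighted measure `dν_{α-1} = (1-x)^{α-1} dx` on `[0,1]`. -/
noncomputable def nuMeas (α : ℝ) : MeasureTheory.Measure ℝ :=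
  (MeasureTheory.volume.restrict (Set.Icc (0:ℝ) 1)).withDensity
    fun x => ENNReal.ofReal ((1 - x) ^ (α - 1))

/-- The space of Müntz polynomials `t ↦ ∑_{k=0}^K a_k t^{λ_k}`. -/
def MuntzPoly (Λ : ℕ → ℝ) : Set (ℝ → ℂ) :=
  { f | ∃ K : ℕ, ∃ a : ℕ → ℂ,
      f = fun t : ℝ => ∑ k ∈ Finset.range (K + 1), a k * ((t ^ (Λ k) : ℝ) : ℂ) }

/-- The block space `F_k = Span{t^λ : λ ∈ E_k}`, where the `k`-th block consists of the
indices `j` with `n k ≤ j < n (k+1)`. -/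
def BlockSpace (Λ : ℕ → ℝ) (n : ℕ → ℕ) (k : ℕ) : Set (ℝ → ℂ) :=
  { f | ∃ a : ℕ → ℂ,
      f = fun t : ℝ => ∑ j ∈ Finset.Ico (n k) (n (k + 1)), a j * ((t ^ (Λ j) : ℝ) : ℂ) }

/-- `Λ` is a quasi-lacunary sequence: an increasing positive sequence with summable
inverses, partitioned into consecutive blocks of length at most `N` (block `k` being the
indices in `[n k, n (k+1))`), whose block endpoints form an (eventually) lacunary
sequence. -/
structure IsQuasiLacunary (Λ : ℕ → ℝ) (n : ℕ → ℕ) (N : ℕ) : Prop where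
  pos : ∀ k, 0 < Λ k
  mono : StrictMono Λ
  sum_inv : Summable fun k => 1 / Λ k
  one_le_N : 1 ≤ N
  n_zero : n 0 = 0
  n_mono : StrictMono n
  block_le : ∀ k, n (k + 1) - n k ≤ N
  ratio : ∃ q : ℝ, 1 < q ∧ ∀ᶠ k in Filter.atTop, q * Λ (n k) < Λ (n (k + 1))

/-- The block endpoints of `Λ` form a subgeometric sequence. -/
def IsSubgeometric (Λ : ℕ → ℝ) (n : ℕ → ℕ) : Prop :=
  ∃ q' : ℝ, 1 < q' ∧ ∀ᶠ k in Filter.atTop, Λ (n (k + 1)) ≤ q' * Λ (n k)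

/-- `T` is a sublinear operator acting on `M_Λ`, producing `μ`-measurable functions. -/
def SublinearOn (Λ : ℕ → ℝ) (μ : MeasureTheory.Measure ℝ)
    (T : (ℝ → ℂ) → ℝ → ℂ) : Prop :=
  (∀ f ∈ MuntzPoly Λ, AEMeasurable (T f) μ) ∧
  (∀ c : ℂ, ∀ f ∈ MuntzPoly Λ, ∀ t : ℝ, ‖T (fun x => c * f x) t‖ = ‖c‖ * ‖T f t‖) ∧
  (∀ f ∈ MuntzPoly Λ, ∀ g ∈ MuntzPoly Λ, ∀ t : ℝ,
      ‖T (f + g) t‖ ≤ ‖T f t‖ + ‖T g t‖) ∧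
  (∀ f ∈ MuntzPoly Λ, ∀ g ∈ MuntzPoly Λ, ∀ t : ℝ,
      ‖T f t - T g t‖ ≤ ‖T (f - g) t‖)

/-- `T` is of restricted weak type `r` with constants `Cr k`:
`μ(|Tf| > λ) ≤ Cr(k)^r λ^{-r} ‖f‖^r_{L^{r/β}(dν_{α-1})}` for every `f ∈ F_k`, `λ > 0`. -/
def RestrictedWeakType (Λ : ℕ → ℝ) (n : ℕ → ℕ) (α β : ℝ)
    (μ : MeasureTheory.Measure ℝ) (T : (ℝ → ℂ) → ℝ → ℂ) (r : ℝ) (Cr : ℕ → ℝ) : Prop :=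
  ∀ k : ℕ, ∀ f ∈ BlockSpace Λ n k, ∀ lam : ℝ, 0 < lam →
    μ {t : ℝ | lam < ‖T f t‖} ≤
      ENNReal.ofReal (Cr k ^ r * lam⁻¹ ^ r) *
        MeasureTheory.eLpNorm f (ENNReal.ofReal (r / β)) (nuMeas α) ^ r

/-- `T` is of restricted strong type `r` with constants `Cr k`:
`‖Tf‖_{L^r(dμ)} ≤ Cr(k) ‖f‖_{L^{r/β}(dν_{α-1})}` for every `f ∈ F_k`. -/
def RestrictedStrongType (Λ : ℕ → ℝ) (n : ℕ → ℕ) (α β : ℝ)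
    (μ : MeasureTheory.Measure ℝ) (T : (ℝ → ℂ) → ℝ → ℂ) (r : ℝ) (Cr : ℕ → ℝ) : Prop :=
  ∀ k : ℕ, ∀ f ∈ BlockSpace Λ n k,
    MeasureTheory.eLpNorm (T f) (ENNReal.ofReal r) μ ≤
      ENNReal.ofReal (Cr k) *
        MeasureTheory.eLpNorm f (ENNReal.ofReal (r / β)) (nuMeas α)

/-- The condition `B_{p,Λ}(α,β)`: `sup_k λ_{n_k}^{αβ} ∫ t^{p λ_{n_k}} dμ < ∞`. -/
def CondB (Λ : ℕ → ℝ) (n : ℕ → ℕ) (α β p : ℝ) (μ : MeasureTheory.Measure ℝ) : Prop :=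
  ∃ B : ℝ, ∀ k : ℕ,
    ENNReal.ofReal (Λ (n k) ^ (α * β)) *
        ∫⁻ t in Set.Icc (0:ℝ) 1, ENNReal.ofReal (t ^ (p * Λ (n k))) ∂μ ≤
      ENNReal.ofReal B

/-- The condition `A_{p,Λ}(α,β)`:
`∑_k λ_{n_k}^{αβ/(1-β)} (∫ t^{p λ_{n_k}} dμ)^{1/(1-β)} < ∞`. -/
def CondA (Λ : ℕ → ℝ) (n : ℕ → ℕ) (α β p : ℝ) (μ : MeasureTheory.Measure ℝ) : Prop :=
  (∑' k : ℕ, ENNReal.ofReal (Λ (n k) ^ (α * β / (1 - β))) *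
      (∫⁻ t in Set.Icc (0:ℝ) 1, ENNReal.ofReal (t ^ (p * Λ (n k))) ∂μ) ^ (1 / (1 - β))) < ⊤

/-- The image under `T` of the unit ball of `M_Λ` (with the `L^{r/β}(dν_{α-1})` norm)
is totally bounded in `L^r(dμ)`. -/
def CompactEmbed (Λ : ℕ → ℝ) (α β r : ℝ) (μ : MeasureTheory.Measure ℝ)
    (T : (ℝ → ℂ) → ℝ → ℂ) : Prop :=
  ∀ δ : ℝ, 0 < δ → ∃ G : Set (ℝ → ℂ), G.Finite ∧
    ∀ f ∈ MuntzPoly Λ,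
      MeasureTheory.eLpNorm f (ENNReal.ofReal (r / β)) (nuMeas α) ≤ 1 →
      ∃ g ∈ G, MeasureTheory.eLpNorm (fun t => T f t - g t) (ENNReal.ofReal r) μ <
        ENNReal.ofReal δ

section MuntzProof

open MeasureTheory Set Filter

/-- Exponential sums `∑_{j<K} a_j e^{-Λ_j s}`. -/
noncomputable def eP (Λ : ℕ → ℝ) (K : ℕ) (a : ℕ → ℂ) (s : ℝ) : ℂ :=
  ∑ j ∈ Finset.range K, a j * ((Real.exp (-(Λ j * s)) : ℝ) : ℂ)

/-- Multiplier bound on the sup space with growth `e^{bs}`. -/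
def MB (Λ : ℕ → ℝ) (K : ℕ) (b c : ℝ) (m : ℕ → ℝ) : Prop :=
  ∀ (a : ℕ → ℂ) (D : ℝ), 0 ≤ D →
    (∀ s, 0 ≤ s → ‖eP Λ K a s‖ ≤ D * Real.exp (b * s)) →
    ∀ s, 0 ≤ s → ‖eP Λ K (fun j => (m j : ℂ) * a j) s‖ ≤ c * D * Real.exp (b * s)

theorem eP_add (Λ : ℕ → ℝ) (K : ℕ) (a a' : ℕ → ℂ) (s : ℝ) :
    eP Λ K (fun j => a j + a' j) s = eP Λ K a s + eP Λ K a' s := by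
  simp [eP, add_mul, Finset.sum_add_distrib]

theorem eP_smul (Λ : ℕ → ℝ) (K : ℕ) (x : ℂ) (a : ℕ → ℂ) (s : ℝ) :
    eP Λ K (fun j => x * a j) s = x * eP Λ K a s := by
  simp [eP, Finset.mul_sum, mul_assoc]

theorem eP_congr {Λ : ℕ → ℝ} {K : ℕ} {a a' : ℕ → ℂ} (h : ∀ j < K, a j = a' j) (s : ℝ) :
    eP Λ K a s = eP Λ K a' s := by
  unfold eP
  apply Finset.sum_congr rfl
  intro j hj
  rw [h j (Finset.mem_range.1 hj)]

theorem eP_continuous (Λ : ℕ → ℝ) (K : ℕ) (a : ℕ → ℂ) : Continuous (eP Λ K a) := by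
  unfold eP
  fun_prop

theorem eP_shift (Λ : ℕ → ℝ) (K : ℕ) (a : ℕ → ℂ) (h s : ℝ) :
    eP Λ K (fun j => ((Real.exp (-(Λ j * h)) : ℝ) : ℂ) * a j) s = eP Λ K a (s + h) := by
  unfold eP
  apply Finset.sum_congr rfl
  intro j _
  have : Real.exp (-(Λ j * (s + h))) = Real.exp (-(Λ j * h)) * Real.exp (-(Λ j * s)) := by
    rw [← Real.exp_add]; ring_nf
  rw [this]; push_cast; ring

theorem MB.mono {Λ : ℕ → ℝ} {K : ℕ} {b c c' : ℝ} {m : ℕ → ℝ} (h : MB Λ K b c m) (hc : c ≤ c') :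
    MB Λ K b c' m := by
  intro a D hD H s hs
  refine (h a D hD H s hs).trans ?_
  gcongr

theorem MB.congr {Λ : ℕ → ℝ} {K : ℕ} {b c : ℝ} {m m' : ℕ → ℝ} (h : MB Λ K b c m)
    (hm : ∀ j < K, m j = m' j) : MB Λ K b c m' := by
  intro a D hD H s hs
  rw [← eP_congr (a := fun j => (m j : ℂ) * a j)]
  · exact h a D hD H s hs
  · intro j hj; simp only [hm j hj]

theorem MB.add {Λ : ℕ → ℝ} {K : ℕ} {b c c' : ℝ} {m m' : ℕ → ℝ} (h : MB Λ K b c m)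
    (h' : MB Λ K b c' m') : MB Λ K b (c + c') (fun j => m j + m' j) := by
  intro a D hD H s hs
  have e : eP Λ K (fun j => ((m j + m' j : ℝ) : ℂ) * a j) s
      = eP Λ K (fun j => (m j : ℂ) * a j) s + eP Λ K (fun j => (m' j : ℂ) * a j) s := by
    rw [← eP_add]; apply eP_congr; intro j _; push_cast; ring
  rw [e]
  calc _ ≤ _ := norm_add_le _ _
    _ ≤ c * D * Real.exp (b * s) + c' * D * Real.exp (b * s) :=
      add_le_add (h a D hD H s hs) (h' a D hD H s hs)
    _ = _ := by ring

theorem MB.mul {Λ : ℕ → ℝ} {K : ℕ} {b c c' : ℝ} {m m' : ℕ → ℝ} (h : MB Λ K b c m)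
    (h' : MB Λ K b c' m') (hc' : 0 ≤ c') : MB Λ K b (c * c') (fun j => m j * m' j) := by
  intro a D hD H s hs
  have := h (fun j => (m' j : ℂ) * a j) (c' * D) (by positivity) (h' a D hD H) s hs
  have e : eP Λ K (fun j => ((m j * m' j : ℝ) : ℂ) * a j) s
      = eP Λ K (fun j => (m j : ℂ) * ((m' j : ℂ) * a j)) s := by
    apply eP_congr; intro j _; push_cast; ring
  rw [e]
  refine this.trans (le_of_eq (by ring))

theorem MB.const (Λ : ℕ → ℝ) (K : ℕ) (b x : ℝ) : MB Λ K b |x| (fun _ => x) := by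
  intro a D hD H s hs
  rw [eP_smul, norm_mul, mul_assoc]
  have : ‖(x : ℂ)‖ = |x| := by simp
  rw [this]
  exact mul_le_mul_of_nonneg_left (H s hs) (abs_nonneg _)

theorem MB.one (Λ : ℕ → ℝ) (K : ℕ) (b : ℝ) : MB Λ K b 1 (fun _ => 1) := by
  simpa using MB.const Λ K b 1

theorem MB.smul {Λ : ℕ → ℝ} {K : ℕ} {b c : ℝ} {m : ℕ → ℝ} (h : MB Λ K b c m) (hc : 0 ≤ c) (x : ℝ) :
    MB Λ K b (|x| * c) (fun j => x * m j) :=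
  (MB.const Λ K b x).mul h hc

theorem MB.neg {Λ : ℕ → ℝ} {K : ℕ} {b c : ℝ} {m : ℕ → ℝ} (h : MB Λ K b c m) (hc : 0 ≤ c) :
    MB Λ K b c (fun j => - m j) := by
  have := (h.smul hc (-1))
  simpa using this

theorem MB.sub {Λ : ℕ → ℝ} {K : ℕ} {b c c' : ℝ} {m m' : ℕ → ℝ} (h : MB Λ K b c m)
    (h' : MB Λ K b c' m') (hc' : 0 ≤ c') : MB Λ K b (c + c') (fun j => m j - m' j) := by
  simpa [sub_eq_add_neg] using h.add (h'.neg hc')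

theorem MB.shift (Λ : ℕ → ℝ) (K : ℕ) (b : ℝ) {h : ℝ} (hh : 0 ≤ h) :
    MB Λ K b (Real.exp (b * h)) (fun j => Real.exp (-(Λ j * h))) := by
  intro a D hD H s hs
  rw [eP_shift]
  refine (H (s + h) (by positivity)).trans (le_of_eq ?_)
  rw [mul_add, Real.exp_add]; ring

theorem MB.pow {Λ : ℕ → ℝ} {K : ℕ} {b c : ℝ} {m : ℕ → ℝ} (h : MB Λ K b c m) (hc : 0 ≤ c) (n : ℕ) :
    MB Λ K b (c ^ n) (fun j => m j ^ n) := by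
  induction n with
  | zero => simpa using MB.one Λ K b
  | succ n ih =>
    simp only [pow_succ]
    exact ih.mul h hc

theorem MB.prod {Λ : ℕ → ℝ} {K : ℕ} {b : ℝ} {ι : Type*} (S : Finset ι) {c : ι → ℝ}
    {m : ι → ℕ → ℝ} (h : ∀ i ∈ S, MB Λ K b (c i) (m i)) (hc : ∀ i ∈ S, 0 ≤ c i) :
    MB Λ K b (∏ i ∈ S, c i) (fun j => ∏ i ∈ S, m i j) := by
  classical
  induction S using Finset.induction_on with
  | empty => simpa using MB.one Λ K b
  | insert i S hi ih =>
    simp only [Finset.prod_insert hi]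
    refine (h i (Finset.mem_insert_self _ _)).mul
      (ih (fun k hk => h k (Finset.mem_insert_of_mem hk))
        (fun k hk => hc k (Finset.mem_insert_of_mem hk))) ?_
    exact Finset.prod_nonneg (fun k hk => hc k (Finset.mem_insert_of_mem hk))

theorem MB.sum {Λ : ℕ → ℝ} {K : ℕ} {b : ℝ} {ι : Type*} (S : Finset ι) {c : ι → ℝ}
    {m : ι → ℕ → ℝ} (h : ∀ i ∈ S, MB Λ K b (c i) (m i)) :
    MB Λ K b (∑ i ∈ S, c i) (fun j => ∑ i ∈ S, m i j) := by
  classical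
  induction S using Finset.induction_on with
  | empty => simpa using MB.const Λ K b 0
  | insert i S hi ih =>
    simp only [Finset.sum_insert hi]
    exact (h i (Finset.mem_insert_self _ _)).add
      (ih (fun k hk => h k (Finset.mem_insert_of_mem hk)))

/-- Resolvent formula. -/
theorem eP_res (Λ : ℕ → ℝ) (hΛ : ∀ j, 0 < Λ j) (K : ℕ) (a : ℕ → ℂ) {B : ℝ} (hB : 0 < B) (s : ℝ) :
    eP Λ K (fun j => ((B / (B + Λ j) : ℝ) : ℂ) * a j) s
      = ∫ x in Ioi s, ((B * Real.exp (-(B * (x - s))) : ℝ) : ℂ) * eP Λ K a x := by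
  have key : ∀ j, IntegrableOn (fun x : ℝ => Real.exp (-(B + Λ j) * x)) (Ioi s) :=
    fun j => integrableOn_exp_mul_Ioi (by have := hΛ j; linarith) s
  have e : ∀ x, ((B * Real.exp (-(B * (x - s))) : ℝ) : ℂ) * eP Λ K a x
      = ∑ j ∈ Finset.range K, (a j * ((B * Real.exp (B * s) : ℝ) : ℂ)) *
          ((Real.exp (-(B + Λ j) * x) : ℝ) : ℂ) := by
    intro x
    unfold eP
    rw [Finset.mul_sum]
    apply Finset.sum_congr rfl
    intro j _
    have : Real.exp (-(B * (x - s))) * Real.exp (-(Λ j * x))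
        = Real.exp (B * s) * Real.exp (-(B + Λ j) * x) := by
      rw [← Real.exp_add, ← Real.exp_add]; ring_nf
    have h2 : ((B * Real.exp (-(B * (x - s))) : ℝ) : ℂ) * (a j * ((Real.exp (-(Λ j * x)) : ℝ) : ℂ))
        = a j * B * ((Real.exp (-(B * (x - s))) * Real.exp (-(Λ j * x)) : ℝ) : ℂ) := by
      push_cast; ring
    rw [h2, this]; push_cast; ring
  simp_rw [e]
  rw [integral_finsetSum]
  · unfold eP
    apply Finset.sum_congr rfl
    intro j _
    rw [integral_const_mul, integral_complex_ofReal, integral_exp_mul_Ioi (by have := hΛ j; linarith)]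
    have hp : B + Λ j ≠ 0 := by have := hΛ j; positivity
    have h3 : Real.exp (-(Λ j * s)) = Real.exp (B * s) * Real.exp (-(B + Λ j) * s) := by
      rw [← Real.exp_add]; ring_nf
    rw [h3]
    have hp' : (B : ℂ) + (Λ j : ℂ) ≠ 0 := by exact_mod_cast hp
    have hp2 : -(B : ℂ) + -(Λ j : ℂ) ≠ 0 := by
      intro h; apply hp'; linear_combination -h
    push_cast
    generalize Complex.exp (↑B * ↑s) = u
    generalize Complex.exp (-(↑B + ↑(Λ j)) * ↑s) = v
    field_simp
  · intro j _
    exact ((key j).ofReal).const_mul _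

theorem MB.res (Λ : ℕ → ℝ) (hΛ : ∀ j, 0 < Λ j) (K : ℕ) {b B : ℝ} (hb : b < B) (hB : 0 < B) :
    MB Λ K b (B / (B - b)) (fun j => B / (B + Λ j)) := by
  intro a D hD H s hs
  rw [eP_res Λ hΛ K a hB]
  have hi : IntegrableOn (fun x : ℝ => (B * D * Real.exp (B * s)) * Real.exp (-(B - b) * x)) (Ioi s) :=
    (integrableOn_exp_mul_Ioi (by linarith) s).const_mul _
  calc _ ≤ ∫ x in Ioi s, (B * D * Real.exp (B * s)) * Real.exp (-(B - b) * x) := by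
        apply norm_integral_le_of_norm_le hi
        filter_upwards [ae_restrict_mem measurableSet_Ioi] with x hx
        have hx' : s < x := hx
        rw [norm_mul, Complex.norm_real, Real.norm_of_nonneg (by positivity)]
        calc _ ≤ B * Real.exp (-(B * (x - s))) * (D * Real.exp (b * x)) := by
              gcongr
              exact H x (by linarith)
          _ = B * D * (Real.exp (-(B * (x - s))) * Real.exp (b * x)) := by ring
          _ = B * D * (Real.exp (B * s) * Real.exp (-(B - b) * x)) := by
              rw [← Real.exp_add, ← Real.exp_add]; ring_nf
          _ = _ := by ring
    _ = _ := by
      rw [integral_const_mul, integral_exp_mul_Ioi (by linarith)]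
      have h3 : Real.exp (b * s) = Real.exp (B * s) * Real.exp (-(B - b) * s) := by
        rw [← Real.exp_add]; ring_nf
      rw [h3]
      have : B - b ≠ 0 := by linarith
      generalize Real.exp (B * s) = u
      generalize Real.exp (-(B - b) * s) = v
      field_simp

theorem eP_rec_step (Λ : ℕ → ℝ) (K : ℕ) {ε h : ℝ} (hε : 0 ≤ ε) (S : Finset ℕ) :
    ∀ (a : ℕ → ℂ), (∀ j, j ∉ S → a j = 0) → (∀ i ∈ S, Real.exp (-(Λ i * h)) ≤ ε) →
    ∀ (D s : ℝ), (∀ m < S.card, ‖eP Λ K a (s + m * h)‖ ≤ D) →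
      ‖eP Λ K a (s + S.card * h)‖ ≤ ((1 + ε) ^ S.card - 1) * D := by
  induction S using Finset.induction_on with
  | empty =>
    intro a ha _ D s _
    have : eP Λ K a (s + (∅ : Finset ℕ).card * h) = 0 := by
      unfold eP
      apply Finset.sum_eq_zero
      intro j _
      rw [ha j (by simp)]; simp
    rw [this]; simp
  | insert i S hi ih =>
    intro a ha hx D s hD
    rw [Finset.card_insert_of_notMem hi] at hD ⊢
    set x := Real.exp (-(Λ i * h)) with hxdef
    have hxε : x ≤ ε := hx i (Finset.mem_insert_self _ _)
    have hx0 : 0 ≤ x := (Real.exp_pos _).le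
    set a' : ℕ → ℂ := fun j => ((Real.exp (-(Λ j * h)) : ℝ) : ℂ) * a j + (-(x : ℂ)) * a j with ha'
    have hw : ∀ y, eP Λ K a' y = eP Λ K a (y + h) - x * eP Λ K a y := by
      intro y
      rw [ha', eP_add, eP_shift, eP_smul]; ring
    have hD' : ∀ m < S.card, ‖eP Λ K a' (s + m * h)‖ ≤ (1 + ε) * D := by
      intro m hm
      rw [hw]
      have h1 := hD m (by omega)
      have h2 := hD (m + 1) (by omega)
      have h3 : s + (m : ℝ) * h + h = s + ((m + 1 : ℕ) : ℝ) * h := by push_cast; ring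
      rw [h3]
      have hD0 : 0 ≤ D := (norm_nonneg _).trans h1
      calc _ ≤ ‖eP Λ K a (s + ((m + 1 : ℕ) : ℝ) * h)‖ + ‖(x : ℂ) * eP Λ K a (s + m * h)‖ :=
            norm_sub_le _ _
        _ ≤ D + ε * D := by
            rw [norm_mul, Complex.norm_real, Real.norm_of_nonneg hx0]
            gcongr
        _ = _ := by ring
    have hs' : ∀ j, j ∉ S → a' j = 0 := by
      intro j hj
      by_cases hji : j = i
      · subst hji; simp only [ha', hxdef]; ring
      · simp only [ha']; rw [ha j (by simp [hji, hj])]; simp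
    have := ih a' hs' (fun j hj => hx j (Finset.mem_insert_of_mem hj)) ((1 + ε) * D) s hD'
    rw [hw] at this
    have hlast := hD S.card (by omega)
    have hD0 : 0 ≤ D := (norm_nonneg _).trans hlast
    have h3 : s + ((S.card + 1 : ℕ) : ℝ) * h = s + (S.card : ℝ) * h + h := by push_cast; ring
    rw [h3]
    calc ‖eP Λ K a (s + (S.card : ℝ) * h + h)‖
        = ‖(eP Λ K a (s + (S.card : ℝ) * h + h) - x * eP Λ K a (s + S.card * h))
            + x * eP Λ K a (s + S.card * h)‖ := by ring_nf
      _ ≤ ((1 + ε) ^ S.card - 1) * ((1 + ε) * D) + ε * D := by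
          refine (norm_add_le _ _).trans (add_le_add this ?_)
          rw [norm_mul, Complex.norm_real, Real.norm_of_nonneg hx0]
          gcongr
      _ = _ := by ring

theorem eP_decay (Λ : ℕ → ℝ) (K L : ℕ) (hL : 1 ≤ L) {ℓ : ℝ} (hℓ : 0 < ℓ) (S : Finset ℕ)
    (hS : S.card ≤ L) (a : ℕ → ℂ) (ha : ∀ j, j ∉ S → a j = 0) (hΛ : ∀ i ∈ S, ℓ ≤ Λ i) {D : ℝ}
    (hD : ∀ s, 0 ≤ s → s ≤ 4 * L ^ 2 / ℓ → ‖eP Λ K a s‖ ≤ D) :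
    ∀ s, 0 ≤ s → ‖eP Λ K a s‖ ≤ D * Real.exp (1 - ℓ * s / (4 * L ^ 2)) := by
  have hL' : (1 : ℝ) ≤ L := by exact_mod_cast hL
  have hL0 : (0 : ℝ) < L := by linarith
  have hD0 : 0 ≤ D := (norm_nonneg _).trans (hD 0 le_rfl (by positivity))
  set h : ℝ := 4 * L / ℓ with hh
  have hhpos : 0 < h := by positivity
  set ε : ℝ := Real.exp (-(4 * L)) with hε
  have hε0 : 0 ≤ ε := (Real.exp_pos _).le
  have hεL : ε * (4 * L) ≤ 1 := by
    rw [hε, Real.exp_neg, inv_mul_le_iff₀ (Real.exp_pos _)]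
    have := Real.add_one_le_exp (4 * (L : ℝ)); linarith
  have hxε : ∀ i ∈ S, Real.exp (-(Λ i * h)) ≤ ε := by
    intro i hi
    apply Real.exp_le_exp.2
    have : ℓ * h = 4 * L := by rw [hh]; field_simp
    have h2 : ℓ * h ≤ Λ i * h := by gcongr; exact hΛ i hi
    linarith
  have hfac : (1 + ε) ^ S.card - 1 ≤ Real.exp (-1) := by
    have h1 : (1 + ε) ^ S.card ≤ Real.exp (1/4) := by
      calc (1 + ε) ^ S.card ≤ (1 + ε) ^ L := pow_le_pow_right₀ (by linarith) hS
        _ ≤ (Real.exp ε) ^ L := by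
            gcongr
            have := Real.add_one_le_exp ε; linarith
        _ = Real.exp (L * ε) := by rw [← Real.exp_nat_mul]
        _ ≤ _ := by apply Real.exp_le_exp.2; nlinarith
    have h2 : Real.exp (1/4) ≤ 4/3 := by
      have := Real.add_one_le_exp (-(1/4 : ℝ))
      rw [Real.exp_neg] at this
      have hp := Real.exp_pos (1/4 : ℝ)
      have h5 : (3/4 : ℝ) * Real.exp (1/4) ≤ 1 := by
        calc _ ≤ (Real.exp (1/4))⁻¹ * Real.exp (1/4) := by gcongr; linarith
          _ = 1 := inv_mul_cancel₀ hp.ne'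
      linarith
    have h3 : (1/3 : ℝ) ≤ Real.exp (-1) := by
      rw [Real.exp_neg, one_div]
      have := Real.exp_one_lt_d9
      gcongr
      linarith
    linarith
  have main : ∀ N : ℕ, ∀ s, 0 ≤ s → s ≤ N * h →
      ‖eP Λ K a s‖ ≤ D * Real.exp (1 - ℓ * s / (4 * L ^ 2)) := by
    intro N
    induction N with
    | zero =>
      intro s hs hs'
      have : s = 0 := by simp at hs'; linarith
      subst this
      refine (hD 0 le_rfl (by positivity)).trans ?_
      simp
      nlinarith [Real.add_one_le_exp (1:ℝ)]
    | succ N ih =>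
      intro s hs hs'
      by_cases hc : s ≤ 4 * L ^ 2 / ℓ
      · refine (hD s hs hc).trans ?_
        have : 1 ≤ Real.exp (1 - ℓ * s / (4 * L ^ 2)) := by
          apply Real.one_le_exp
          rw [le_div_iff₀ hℓ] at hc
          rw [sub_nonneg, div_le_one (by positivity)]; linarith
        nlinarith
      · push Not at hc
        have hLh : (L : ℝ) * h = 4 * L ^ 2 / ℓ := by rw [hh]; ring
        have hcard : (S.card : ℝ) ≤ L := by exact_mod_cast hS
        have h0 : (S.card : ℝ) * h ≤ L * h := by gcongr
        have key := eP_rec_step Λ K hε0 S a ha hxε (D * Real.exp (2 - ℓ * s / (4 * L ^ 2)))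
          (s - S.card * h) (by
            intro m hm
            have hm' : (m : ℝ) + 1 ≤ S.card := by exact_mod_cast hm
            have hm0 : (0 : ℝ) ≤ m := Nat.cast_nonneg m
            refine (ih _ ?_ ?_).trans ?_
            · have : 0 ≤ (m : ℝ) * h := by positivity
              linarith
            · push_cast at hs'
              nlinarith
            · refine mul_le_mul_of_nonneg_left (Real.exp_le_exp.2 ?_) hD0
              have e1 : ℓ * (L * h) / (4 * L ^ 2) = 1 := by rw [hLh]; field_simp
              have e2 : ℓ * (s - L * h) / (4 * L ^ 2) ≤ ℓ * (s - S.card * h + m * h) / (4 * L ^ 2) := by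
                gcongr
                nlinarith
              have e3 : ℓ * (s - L * h) / (4 * L ^ 2) = ℓ * s / (4 * L ^ 2) - 1 := by
                rw [← e1]; ring
              linarith)
        rw [sub_add_cancel] at key
        refine key.trans ?_
        calc _ ≤ Real.exp (-1) * (D * Real.exp (2 - ℓ * s / (4 * L ^ 2))) := by gcongr
          _ = D * (Real.exp (-1) * Real.exp (2 - ℓ * s / (4 * L ^ 2))) := by ring
          _ = _ := by rw [← Real.exp_add]; ring_nf
  intro s hs
  obtain ⟨N, hN⟩ := exists_nat_ge (s / h)
  exact main N s hs (by rwa [div_le_iff₀ hhpos] at hN)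

theorem prod_one_sub_lb {ι : Type*} (S : Finset ι) (x : ι → ℝ) {r : ℝ} (hr : r < 1)
    (h0 : ∀ i ∈ S, 0 ≤ x i) (h1 : ∀ i ∈ S, x i ≤ r) :
    Real.exp (-((∑ i ∈ S, x i) / (1 - r))) ≤ ∏ i ∈ S, (1 - x i) := by
  rw [Finset.sum_div, ← Finset.sum_neg_distrib, Real.exp_sum]
  apply Finset.prod_le_prod
  · intros; exact (Real.exp_pos _).le
  · intro i hi
    have a0 := h0 i hi
    have a1 := h1 i hi
    have hpos : 0 < 1 - x i := by linarith
    have hpos' : 0 < 1 - r := by linarith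
    rw [Real.exp_neg, inv_le_comm₀ (Real.exp_pos _) hpos]
    calc (1 - x i)⁻¹ = x i / (1 - x i) + 1 := by field_simp; ring
      _ ≤ x i / (1 - r) + 1 := by gcongr
      _ ≤ _ := Real.add_one_le_exp _

theorem prod_telescope (η : ℕ → ℝ) (m : ℕ) :
    ∏ i ∈ Finset.range m, (1 - η i)
      = 1 - ∑ i ∈ Finset.range m, η i * ∏ j ∈ Finset.Ico (i + 1) m, (1 - η j) := by
  induction m with
  | zero => simp
  | succ m ih =>
    rw [Finset.prod_range_succ, ih, Finset.sum_range_succ]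
    have : ∑ i ∈ Finset.range m, η i * ∏ j ∈ Finset.Ico (i + 1) (m + 1), (1 - η j)
        = (∑ i ∈ Finset.range m, η i * ∏ j ∈ Finset.Ico (i + 1) m, (1 - η j)) * (1 - η m) := by
      rw [Finset.sum_mul]
      apply Finset.sum_congr rfl
      intro i hi
      rw [Finset.prod_Ico_succ_top (by have := Finset.mem_range.1 hi; omega)]
      ring
    rw [this]; simp; ring

/-- Block `[m,m')` separated from the rest of the sequence. -/
structure Blk (θ Q : ℝ) (L : ℕ) (Λ : ℕ → ℝ) (m m' : ℕ) : Prop where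
  pos : ∀ j, 0 < Λ j
  mono : Monotone Λ
  lt : m < m'
  len : m' ≤ m + L
  low : ∀ i < m, θ ^ (m - i) * Λ i ≤ Λ m
  blk : ∀ i, m ≤ i → i < m' → Λ i ≤ Q * Λ m
  high : ∀ j, m' ≤ j → ∀ i, m ≤ i → i < m' → θ ^ (j - m' + 1) * Λ i ≤ Λ j

/-- shift length for killing the exponent `Λ j`, `j ≥ m'`. -/
noncomputable def hS (Λ : ℕ → ℝ) (m' j : ℕ) : ℝ := ((j - m' + 1 : ℕ) : ℝ) / Λ j

/-- multiplier killing high exponents -/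
noncomputable def hiM (Λ : ℕ → ℝ) (m' K : ℕ) (z : ℝ) : ℝ :=
  ∏ j ∈ Finset.Ico m' K, (Real.exp (-(z * hS Λ m' j)) - Real.exp (-(Λ j * hS Λ m' j)))

theorem sum_Ico_shift_le (g : ℕ → ℝ) (hg : Summable g) (h0 : ∀ p, 0 ≤ g p) (m' K : ℕ) :
    ∑ j ∈ Finset.Ico m' K, g (j - m' + 1) ≤ ∑' p, g p := by
  rw [Finset.sum_Ico_eq_sum_range]
  have : ∀ k, m' + k - m' + 1 = k + 1 := fun k => by omega
  simp_rw [this]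
  calc ∑ k ∈ Finset.range (K - m'), g (k + 1) ≤ ∑ k ∈ Finset.range (K - m' + 1), g k := by
        rw [Finset.sum_range_succ']; linarith [h0 0]
    _ ≤ _ := hg.sum_le_tsum _ (fun i _ => h0 i)

theorem sum_range_rev_le (g : ℕ → ℝ) (hg : Summable g) (h0 : ∀ p, 0 ≤ g p) (m : ℕ) :
    ∑ i ∈ Finset.range m, g (m - i) ≤ ∑' p, g p := by
  rw [← Finset.sum_range_reflect]
  calc _ = ∑ k ∈ Finset.range m, g (k + 1) := by
        apply Finset.sum_congr rfl
        intro k hk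
        have := Finset.mem_range.1 hk
        congr 1; omega
    _ ≤ ∑ k ∈ Finset.range (m + 1), g k := by
        rw [Finset.sum_range_succ']; linarith [h0 0]
    _ ≤ _ := hg.sum_le_tsum _ (fun i _ => h0 i)

theorem summable_pgeo {r : ℝ} (h0 : 0 ≤ r) (h1 : r < 1) : Summable (fun p : ℕ => (p : ℝ) * r ^ p) := by
  have := summable_pow_mul_geometric_of_norm_lt_one (R := ℝ) 1 (r := r)
    (by rwa [Real.norm_of_nonneg h0])
  simpa using this

theorem hiM_MB (θ Q : ℝ) (L : ℕ) (hθ : 1 < θ) : ∃ C, 0 < C ∧ ∀ Λ m m' K, Blk θ Q L Λ m m' →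
    ∀ b, 0 ≤ b → b ≤ Λ m → MB Λ K b C (fun j => hiM Λ m' K (Λ j)) := by
  have hr0 : 0 ≤ θ⁻¹ := by positivity
  have hr1 : θ⁻¹ < 1 := inv_lt_one_of_one_lt₀ hθ
  have he0 : 0 ≤ Real.exp (-1) := (Real.exp_pos _).le
  have he1 : Real.exp (-1) < 1 := by rw [Real.exp_lt_one_iff]; norm_num
  set g : ℕ → ℝ := fun p => (p : ℝ) * θ⁻¹ ^ p + Real.exp (-1) ^ p with hg
  have hgs : Summable g := (summable_pgeo hr0 hr1).add (summable_geometric_of_lt_one he0 he1)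
  have hg0 : ∀ p, 0 ≤ g p := fun p => by simp only [hg]; positivity
  refine ⟨Real.exp (∑' p, g p), Real.exp_pos _, ?_⟩
  intro Λ m m' K hB b hb0 hb
  have hstep : ∀ j ∈ Finset.Ico m' K, MB Λ K b (Real.exp (g (j - m' + 1)))
      (fun i => Real.exp (-(Λ i * hS Λ m' j)) - Real.exp (-(Λ j * hS Λ m' j))) := by
    intro j hj
    have hj' := (Finset.mem_Ico.1 hj).1
    have hpj := hB.pos j
    have hh0 : 0 ≤ hS Λ m' j := by unfold hS; positivity
    have := (MB.shift Λ K b hh0).sub (MB.const Λ K b (Real.exp (-(Λ j * hS Λ m' j)))) (abs_nonneg _)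
    refine this.mono ?_
    rw [abs_of_pos (Real.exp_pos _)]
    set p := j - m' + 1 with hp
    have e1 : Λ j * hS Λ m' j = p := by unfold hS; rw [← hp]; field_simp
    have e2 : b * hS Λ m' j ≤ p * θ⁻¹ ^ p := by
      have h1 := hB.high j hj' m le_rfl hB.lt
      rw [← hp] at h1
      have h2 : b / Λ j ≤ θ⁻¹ ^ p := by
        rw [div_le_iff₀ hpj, inv_pow]
        have : 0 < θ ^ p := by positivity
        rw [le_inv_mul_iff₀ this]
        nlinarith
      calc b * hS Λ m' j = p * (b / Λ j) := by unfold hS; rw [← hp]; ring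
        _ ≤ _ := by gcongr
    rw [e1]
    have e3 : Real.exp (-(p : ℝ)) = Real.exp (-1) ^ p := by
      rw [← Real.exp_nat_mul]; ring_nf
    rw [e3]
    have e4 : 1 ≤ Real.exp ((p : ℝ) * θ⁻¹ ^ p) := Real.one_le_exp (by positivity)
    have e5 : Real.exp (b * hS Λ m' j) ≤ Real.exp ((p : ℝ) * θ⁻¹ ^ p) := Real.exp_le_exp.2 e2
    have e6 := Real.add_one_le_exp (Real.exp (-1) ^ p)
    have e7 : 0 ≤ Real.exp (-1) ^ p := by positivity
    simp only [hg]
    rw [Real.exp_add]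
    calc _ ≤ Real.exp ((p : ℝ) * θ⁻¹ ^ p) * (Real.exp (-1) ^ p + 1) := by nlinarith
      _ ≤ _ := by gcongr
  have := MB.prod (Finset.Ico m' K) hstep (fun _ _ => (Real.exp_pos _).le)
  unfold hiM
  refine this.mono ?_
  rw [← Real.exp_sum]
  exact Real.exp_le_exp.2 (sum_Ico_shift_le g hgs hg0 m' K)

theorem hiM_lb (θ Q : ℝ) (L : ℕ) (hθ : 1 < θ) : ∃ c, 0 < c ∧ ∀ Λ m m' K, Blk θ Q L Λ m m' →
    ∀ i, m ≤ i → i < m' → c ≤ hiM Λ m' K (Λ i) := by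
  have hr0 : 0 ≤ θ⁻¹ := by positivity
  have hr1 : θ⁻¹ < 1 := inv_lt_one_of_one_lt₀ hθ
  set r : ℝ := Real.exp (-(1 - θ⁻¹)) with hr
  have hrp : 0 ≤ r := (Real.exp_pos _).le
  have hr1' : r < 1 := by rw [hr, Real.exp_lt_one_iff]; linarith
  have s1 := summable_pgeo hr0 hr1
  have s2 := summable_geometric_of_lt_one hrp hr1'
  refine ⟨Real.exp (-(∑' p : ℕ, (p : ℝ) * θ⁻¹ ^ p)) * Real.exp (-((∑' p : ℕ, r ^ p) / (1 - r))),
    by positivity, ?_⟩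
  intro Λ m m' K hB i hi hi'
  have hpi := hB.pos i
  set x : ℕ → ℝ := fun j => Real.exp (-((Λ j - Λ i) * hS Λ m' j)) with hx
  have hfac : ∀ j, Real.exp (-(Λ i * hS Λ m' j)) - Real.exp (-(Λ j * hS Λ m' j))
      = Real.exp (-(Λ i * hS Λ m' j)) * (1 - x j) := by
    intro j
    rw [mul_sub, mul_one, hx, ← Real.exp_add]; ring_nf
  unfold hiM
  simp_rw [hfac]
  rw [Finset.prod_mul_distrib]
  have hkey : ∀ j ∈ Finset.Ico m' K, Λ i * hS Λ m' j ≤ ((j - m' + 1 : ℕ) : ℝ) * θ⁻¹ ^ (j - m' + 1)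
      ∧ x j ≤ r ^ (j - m' + 1) := by
    intro j hj
    have hj' := (Finset.mem_Ico.1 hj).1
    have hpj := hB.pos j
    set p := j - m' + 1 with hp
    have h1 := hB.high j hj' i hi hi'
    rw [← hp] at h1
    have h2 : Λ i / Λ j ≤ θ⁻¹ ^ p := by
      rw [div_le_iff₀ hpj, inv_pow]
      have : 0 < θ ^ p := by positivity
      rwa [le_inv_mul_iff₀ this]
    have e1 : Λ j * hS Λ m' j = p := by unfold hS; rw [← hp]; field_simp
    have e2 : Λ i * hS Λ m' j = p * (Λ i / Λ j) := by unfold hS; rw [← hp]; ring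
    refine ⟨by rw [e2]; gcongr, ?_⟩
    simp only [hx]
    rw [hr, ← Real.exp_nat_mul]
    apply Real.exp_le_exp.2
    rw [sub_mul, e1, e2]
    have h3 : θ⁻¹ ^ p ≤ θ⁻¹ := by
      have := pow_le_of_le_one hr0 hr1.le (n := p) (by omega)
      exact this
    have : (p : ℝ) * (Λ i / Λ j) ≤ p * θ⁻¹ := by gcongr; linarith
    linarith
  have h1 : Real.exp (-(∑' p : ℕ, (p : ℝ) * θ⁻¹ ^ p))
      ≤ ∏ j ∈ Finset.Ico m' K, Real.exp (-(Λ i * hS Λ m' j)) := by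
    rw [← Real.exp_sum, Finset.sum_neg_distrib]
    apply Real.exp_le_exp.2
    apply neg_le_neg
    refine (Finset.sum_le_sum (fun j hj => (hkey j hj).1)).trans ?_
    exact sum_Ico_shift_le (fun p : ℕ => (p : ℝ) * θ⁻¹ ^ p) s1 (fun p => by positivity) m' K
  have h2 : Real.exp (-((∑' p : ℕ, r ^ p) / (1 - r))) ≤ ∏ j ∈ Finset.Ico m' K, (1 - x j) := by
    refine le_trans ?_ (prod_one_sub_lb _ x hr1' (fun j _ => (Real.exp_pos _).le) ?_)
    · apply Real.exp_le_exp.2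
      apply neg_le_neg
      have : 0 < 1 - r := by linarith
      gcongr
      refine (Finset.sum_le_sum (fun j hj => (hkey j hj).2)).trans ?_
      exact sum_Ico_shift_le (fun p : ℕ => r ^ p) s2 (fun p => by positivity) m' K
    · intro j hj
      refine (hkey j hj).2.trans (pow_le_of_le_one hrp hr1'.le (by omega))
  exact mul_le_mul h1 h2 (Real.exp_pos _).le (Finset.prod_nonneg (fun _ _ => (Real.exp_pos _).le))

/-- low-exponent killing profile -/
noncomputable def etaM (M : ℕ) (Λ : ℕ → ℝ) (i : ℕ) (z : ℝ) : ℝ :=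
  (((M : ℝ) + 2) * Λ i / (z + ((M : ℝ) + 1) * Λ i)) ^ M

/-- high pass -/
noncomputable def hpM (M : ℕ) (ℓ z : ℝ) : ℝ := z / (z + 2 * ((M : ℝ) + 1) * ℓ)

theorem eta_MB (M : ℕ) (hM : 1 ≤ M) (Λ : ℕ → ℝ) (hΛ : ∀ j, 0 < Λ j) (K i : ℕ) {b : ℝ}
    (hb : b ≤ Λ i) : MB Λ K b 9 (fun j => 1 - etaM M Λ i (Λ j)) := by
  have hM' : (1 : ℝ) ≤ M := by exact_mod_cast hM
  have hi := hΛ i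
  set A : ℝ := (M : ℝ) + 1 with hA
  have hAi : 0 < A * Λ i := by positivity
  have hlt : b < A * Λ i := by nlinarith
  have h1 := MB.res Λ hΛ K hlt hAi
  have hc1 : A * Λ i / (A * Λ i - b) ≤ A / (M : ℝ) := by
    rw [div_le_div_iff₀ (by linarith) (by linarith)]
    nlinarith
  have h2 := ((h1.mono hc1).smul (by positivity) ((A + 1) / A)).pow (by positivity) M
  have h3 : MB Λ K b 8 (fun j => etaM M Λ i (Λ j)) := by
    refine (h2.mono ?_).congr ?_
    · rw [abs_of_pos (by positivity)]
      have : (A + 1) / A * (A / M) = 2 / M + 1 := by rw [hA]; field_simp; ring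
      rw [this]
      calc (2 / (M : ℝ) + 1) ^ M ≤ (Real.exp (2 / M)) ^ M := by
            gcongr; exact Real.add_one_le_exp _
        _ = Real.exp 2 := by
            rw [← Real.exp_nat_mul]; congr 1; field_simp
        _ = (Real.exp 1) ^ 2 := by rw [← Real.exp_nat_mul]; norm_num
        _ ≤ 2.72 ^ 2 := by
            have := Real.exp_one_lt_d9
            gcongr; linarith
        _ ≤ 8 := by norm_num
    · intro j _
      have hj := hΛ j
      unfold etaM
      congr 1
      have : A * Λ i + Λ j ≠ 0 := by positivity
      have hA0 : A ≠ 0 := by positivity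
      rw [← hA, show (M : ℝ) + 2 = A + 1 by rw [hA]; ring, add_comm (Λ j)]
      field_simp
  have := (MB.one Λ K b).sub h3 (by norm_num)
  exact this.mono (by norm_num)

theorem hp_MB (M : ℕ) (Λ : ℕ → ℝ) (hΛ : ∀ j, 0 < Λ j) (K : ℕ) {b ℓ : ℝ} (hℓ : 0 < ℓ)
    (hb : b ≤ ℓ) : MB Λ K b 3 (fun j => hpM M ℓ (Λ j)) := by
  have hM' : (0 : ℝ) ≤ M := by positivity
  have hB : 0 < 2 * ((M : ℝ) + 1) * ℓ := by positivity
  have hlt : b < 2 * ((M : ℝ) + 1) * ℓ := by nlinarith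
  have h1 := MB.res Λ hΛ K hlt hB
  have h2 := (MB.one Λ K b).sub (h1.mono (c' := 2) (by
    rw [div_le_iff₀ (by linarith)]; nlinarith)) (by norm_num)
  refine (h2.mono (by norm_num)).congr ?_
  intro j _
  have hj := hΛ j
  unfold hpM
  have : 2 * ((M : ℝ) + 1) * ℓ + Λ j ≠ 0 := by positivity
  rw [add_comm (Λ j)]
  field_simp
  ring

theorem hp_eta_MB (M : ℕ) (hM : 1 ≤ M) (Λ : ℕ → ℝ) (hΛ : ∀ j, 0 < Λ j) (K i : ℕ) {b ℓ : ℝ}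
    (hb : b ≤ Λ i) (hi' : Λ i ≤ ℓ) :
    MB Λ K b (8 * (4 * (Λ i / ℓ)) ^ M) (fun j => hpM M ℓ (Λ j) ^ M * etaM M Λ i (Λ j)) := by
  have hM' : (1 : ℝ) ≤ M := by exact_mod_cast hM
  have hi := hΛ i
  have hℓ : 0 < ℓ := by linarith
  set A : ℝ := (M : ℝ) + 1 with hA
  have hC0 : 0 < A * Λ i := by positivity
  have hB0 : 0 < 2 * A * ℓ := by positivity
  have hltC : b < A * Λ i := by nlinarith
  have hltB : b < 2 * A * ℓ := by nlinarith
  have h1 := (MB.res Λ hΛ K hltC hC0).mono (c' := 2) (by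
    rw [div_le_iff₀ (by linarith)]; nlinarith)
  have h2 := (MB.res Λ hΛ K hltB hB0).mono (c' := 2) (by
    rw [div_le_iff₀ (by linarith)]; nlinarith)
  have hBC : A * ℓ ≤ 2 * A * ℓ - A * Λ i := by nlinarith
  have hBC0 : 0 < 2 * A * ℓ - A * Λ i := by nlinarith
  have h3 := (h2.sub h1 (by norm_num)).smul (by norm_num) (A * Λ i / (2 * A * ℓ - A * Λ i))
  have h4 := ((h3.mono (c' := 4 * (Λ i / ℓ)) (by
    rw [abs_of_pos (by positivity)]
    have : A * Λ i / (2 * A * ℓ - A * Λ i) ≤ Λ i / ℓ := by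
      rw [div_le_div_iff₀ hBC0 hℓ]
      nlinarith
    linarith)).pow (by positivity) M).smul (by positivity) (((A + 1) / A) ^ M)
  refine (h4.mono ?_).congr ?_
  · rw [abs_of_pos (by positivity)]
    gcongr
    calc ((A + 1) / A) ^ M = (1 / A + 1) ^ M := by
          have hA0 : A ≠ 0 := by positivity
          congr 1; field_simp; ring
      _ ≤ (Real.exp (1 / A)) ^ M := by gcongr; exact Real.add_one_le_exp _
      _ = Real.exp (M * (1 / A)) := by rw [← Real.exp_nat_mul]
      _ ≤ Real.exp 1 := by
          apply Real.exp_le_exp.2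
          rw [mul_one_div, div_le_one (by positivity)]; rw [hA]; linarith
      _ ≤ 8 := by have := Real.exp_one_lt_d9; linarith
  · intro j _
    have hj := hΛ j
    unfold etaM hpM
    rw [← mul_pow, ← mul_pow]
    congr 1
    have n1 : A * Λ i + Λ j ≠ 0 := by positivity
    have n2 : 2 * A * ℓ + Λ j ≠ 0 := by positivity
    rw [← hA, show (M : ℝ) + 2 = A + 1 by rw [hA]; ring, add_comm (Λ j), add_comm (Λ j)]
    have n3 := hBC0.ne'
    have n4 : A ≠ 0 := by positivity
    generalize hc : 2 * A * ℓ - A * Λ i = w at *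
    have hc' : 2 * A * ℓ = w + A * Λ i := by linarith
    rw [hc'] at n2 ⊢
    field_simp
    ring

theorem low_lb (θ Q : ℝ) (L M : ℕ) (hM : 1 ≤ M) (hθ : 1 < θ) :
    ∃ c, 0 < c ∧ ∀ Λ m m', Blk θ Q L Λ m m' →
    ∀ z, Λ m ≤ z → c ≤ ∏ i ∈ Finset.range m, (1 - etaM M Λ i z) := by
  have hr0 : 0 ≤ θ⁻¹ := by positivity
  have hr1 : θ⁻¹ < 1 := inv_lt_one_of_one_lt₀ hθ
  set A : ℝ := (M : ℝ) + 1 with hA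
  set r : ℝ := (A + 1) / (θ + A) with hr
  have hr1' : r < 1 := by rw [hr, div_lt_one (by positivity)]; linarith
  have s2 := (summable_geometric_of_lt_one hr0 hr1).mul_left (A + 1)
  refine ⟨Real.exp (-((∑' p : ℕ, (A + 1) * θ⁻¹ ^ p) / (1 - r))), Real.exp_pos _, ?_⟩
  intro Λ m m' hB z hz
  have key : ∀ i ∈ Finset.range m, 0 ≤ etaM M Λ i z ∧ etaM M Λ i z ≤ r ∧
      etaM M Λ i z ≤ (A + 1) * θ⁻¹ ^ (m - i) := by
    intro i hi
    have him := Finset.mem_range.1 hi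
    have hpi := hB.pos i
    have hl := hB.low i him
    have hθp : θ ≤ θ ^ (m - i) := by
      have := le_self_pow₀ hθ.le (n := m - i) (by omega)
      exact this
    have hz0 : 0 < z := lt_of_lt_of_le (hB.pos m) hz
    have hθz : θ * Λ i ≤ z := by nlinarith
    have hθpp : 0 < θ ^ (m - i) := by positivity
    set y := (A + 1) * Λ i / (z + A * Λ i) with hy
    have hy0 : 0 ≤ y := by positivity
    have hyr : y ≤ r := by
      rw [hy, hr, div_le_div_iff₀ (by positivity) (by positivity)]
      nlinarith [mul_le_mul_of_nonneg_left hθz (show (0:ℝ) ≤ A + 1 by positivity)]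
    have hyg : y ≤ (A + 1) * θ⁻¹ ^ (m - i) := by
      rw [hy, inv_pow, ← div_eq_mul_inv, div_le_div_iff₀ (by positivity) hθpp]
      have : Λ i * θ ^ (m - i) ≤ z + A * Λ i := by
        have : 0 ≤ A * Λ i := by positivity
        nlinarith
      nlinarith [mul_le_mul_of_nonneg_left this (show (0:ℝ) ≤ A + 1 by positivity)]
    have he : etaM M Λ i z = y ^ M := by
      unfold etaM; rw [hy, hA]; ring_nf
    rw [he]
    have : y ^ M ≤ y := pow_le_of_le_one hy0 (by linarith) (by omega)
    exact ⟨by positivity, by linarith, by linarith⟩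
  refine le_trans ?_ (prod_one_sub_lb _ (fun i => etaM M Λ i z) hr1'
    (fun i hi => (key i hi).1) (fun i hi => (key i hi).2.1))
  apply Real.exp_le_exp.2
  apply neg_le_neg
  have : 0 < 1 - r := by linarith
  gcongr
  refine (Finset.sum_le_sum (fun i hi => (key i hi).2.2)).trans ?_
  exact sum_range_rev_le (fun p : ℕ => (A + 1) * θ⁻¹ ^ p) s2 (fun p => by positivity) m

/-- smoothing multiplier -/
noncomputable def gM (ℓ z : ℝ) : ℝ := Real.exp (-(z * (1 / ℓ))) * (ℓ / (ℓ + z))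

/-- weighted mean of the size of an exponential polynomial -/
noncomputable def DK (ℓ : ℝ) (F : ℝ → ℂ) : ℝ := ℓ * ∫ x in Ioi (1 / ℓ), ‖F x‖ * ((ℓ * x) ^ 2)⁻¹

theorem eP_norm_le (Λ : ℕ → ℝ) (hΛ : ∀ j, 0 < Λ j) (K : ℕ) (a : ℕ → ℂ) {s : ℝ} (hs : 0 ≤ s) :
    ‖eP Λ K a s‖ ≤ ∑ j ∈ Finset.range K, ‖a j‖ := by
  unfold eP
  refine (norm_sum_le _ _).trans (Finset.sum_le_sum ?_)
  intro j _
  have : Real.exp (-(Λ j * s)) ≤ 1 := by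
    rw [Real.exp_le_one_iff]; have := mul_nonneg (hΛ j).le hs; linarith
  rw [norm_mul, Complex.norm_real, Real.norm_of_nonneg (Real.exp_pos _).le]
  exact mul_le_of_le_one_right (norm_nonneg _) this

theorem DK_integrable (Λ : ℕ → ℝ) (hΛ : ∀ j, 0 < Λ j) (K : ℕ) (a : ℕ → ℂ) {ℓ c : ℝ} (hℓ : 0 < ℓ)
    (hc : 0 < c) :
    IntegrableOn (fun x => ‖eP Λ K a x‖ * ((ℓ * x) ^ 2)⁻¹) (Ioi c) := by
  have h1 : IntegrableOn (fun x : ℝ => (∑ j ∈ Finset.range K, ‖a j‖) * (ℓ ^ 2)⁻¹ * x ^ (-2 : ℝ)) (Ioi c) :=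
    (integrableOn_Ioi_rpow_of_lt (by norm_num) hc).const_mul _
  refine Integrable.mono' h1 ?_ ?_
  · apply Measurable.aestronglyMeasurable
    have := (eP_continuous Λ K a).measurable
    fun_prop
  · refine (ae_restrict_iff' measurableSet_Ioi).2 (Eventually.of_forall ?_)
    intro x hx
    have hx0 : 0 < x := hc.trans hx
    rw [Real.norm_of_nonneg (by positivity)]
    have e : x ^ (-2 : ℝ) = (x ^ 2)⁻¹ := by
      rw [Real.rpow_neg hx0.le]; norm_num
    rw [e, mul_pow, mul_inv, mul_assoc]
    gcongr
    exact eP_norm_le Λ hΛ K a hx0.le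

theorem DK_nonneg {ℓ : ℝ} (hℓ : 0 < ℓ) (F : ℝ → ℂ) : 0 ≤ DK ℓ F := by
  unfold DK
  apply mul_nonneg hℓ.le
  apply setIntegral_nonneg measurableSet_Ioi
  intro x _; positivity

theorem exp_neg_le_two_div {y : ℝ} (hy : 0 < y) : Real.exp (-y) ≤ 2 * (y ^ 2)⁻¹ := by
  have := Real.quadratic_le_exp_of_nonneg hy.le
  rw [Real.exp_neg, ← div_eq_mul_inv, inv_le_comm₀ (Real.exp_pos _) (by positivity), inv_div]
  linarith

theorem gM_bound (Λ : ℕ → ℝ) (hΛ : ∀ j, 0 < Λ j) (K : ℕ) (a : ℕ → ℂ) {ℓ b : ℝ} (hb : 0 < b)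
    (hbℓ : b ≤ ℓ) {s : ℝ} (hs : 0 ≤ s) :
    ‖eP Λ K (fun j => (gM ℓ (Λ j) : ℂ) * a j) s‖
      ≤ (2 * Real.exp 1 * DK ℓ (eP Λ K a)) * (ℓ / b) ^ 2 * Real.exp (b * s) := by
  have hℓ : 0 < ℓ := hb.trans_le hbℓ
  have e : eP Λ K (fun j => (gM ℓ (Λ j) : ℂ) * a j) s
      = eP Λ K (fun j => ((ℓ / (ℓ + Λ j) : ℝ) : ℂ) * a j) (s + 1 / ℓ) := by
    rw [← eP_shift]
    apply eP_congr; intro j _; unfold gM; push_cast; ring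
  rw [e, eP_res Λ hΛ K a hℓ]
  have hs' : 0 < s + 1 / ℓ := by positivity
  set C : ℝ := 2 * Real.exp 1 * ℓ * (ℓ / b) ^ 2 * Real.exp (b * s) with hC
  have hC0 : 0 ≤ C := by positivity
  have hI := DK_integrable Λ hΛ K a hℓ (c := 1 / ℓ) (by positivity)
  have hsub : Ioi (s + 1 / ℓ) ⊆ Ioi (1 / ℓ) := Ioi_subset_Ioi (by linarith)
  calc _ ≤ ∫ x in Ioi (s + 1 / ℓ), C * (‖eP Λ K a x‖ * ((ℓ * x) ^ 2)⁻¹) := by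
        refine norm_integral_le_of_norm_le ((hI.mono_set hsub).const_mul C) ?_
        refine (ae_restrict_iff' measurableSet_Ioi).2 (Eventually.of_forall ?_)
        intro x hx
        have hx' : s + 1 / ℓ < x := hx
        have hx0 : 0 < x := hs'.trans hx'
        have hxs : 0 < x - s := by have : 0 < 1 / ℓ := by positivity
                                   linarith
        rw [norm_mul, Complex.norm_real, Real.norm_of_nonneg (by positivity)]
        have k1 : Real.exp (-(ℓ * (x - (s + 1 / ℓ)))) ≤ Real.exp 1 * Real.exp (b * s) * Real.exp (-(b * x)) := by
          rw [← Real.exp_add, ← Real.exp_add]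
          apply Real.exp_le_exp.2
          have : ℓ * (1 / ℓ) = 1 := by field_simp
          nlinarith
        have k2 := exp_neg_le_two_div (show 0 < b * x by positivity)
        have k3 : ℓ * Real.exp (-(ℓ * (x - (s + 1 / ℓ)))) ≤ C * ((ℓ * x) ^ 2)⁻¹ := by
          calc _ ≤ ℓ * (Real.exp 1 * Real.exp (b * s) * (2 * ((b * x) ^ 2)⁻¹)) := by
                gcongr; exact k1.trans (by gcongr)
            _ = _ := by rw [hC]; field_simp
        calc _ ≤ C * ((ℓ * x) ^ 2)⁻¹ * ‖eP Λ K a x‖ := by gcongr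
          _ = _ := by ring
    _ = C * ∫ x in Ioi (s + 1 / ℓ), (‖eP Λ K a x‖ * ((ℓ * x) ^ 2)⁻¹) := integral_const_mul _ _
    _ ≤ C * ∫ x in Ioi (1 / ℓ), (‖eP Λ K a x‖ * ((ℓ * x) ^ 2)⁻¹) := by
        gcongr
        exact Eventually.of_forall (fun x => by positivity)
    _ = _ := by rw [hC]; unfold DK; ring

/-- main multiplier -/
noncomputable def uM (M : ℕ) (Λ : ℕ → ℝ) (m m' K : ℕ) (z : ℝ) : ℝ :=
  hpM M (Λ m) z ^ M * (∏ i ∈ Finset.range m, (1 - etaM M Λ i z)) * hiM Λ m' K z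

theorem uM_tele (M : ℕ) (Λ : ℕ → ℝ) (m m' K : ℕ) (z : ℝ) :
    uM M Λ m m' K z = hpM M (Λ m) z ^ M * hiM Λ m' K z -
      ∑ i ∈ Finset.range m, (hpM M (Λ m) z ^ M * etaM M Λ i z) *
        (∏ j ∈ Finset.Ico (i + 1) m, (1 - etaM M Λ j z)) * hiM Λ m' K z := by
  unfold uM
  rw [prod_telescope (fun i => etaM M Λ i z), mul_sub, sub_mul, mul_one, Finset.mul_sum, Finset.sum_mul]
  congr 1
  apply Finset.sum_congr rfl
  intro i _; ring

theorem eP_sum {ι : Type*} (Λ : ℕ → ℝ) (K : ℕ) (S : Finset ι) (a : ι → ℕ → ℂ) (s : ℝ) :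
    eP Λ K (fun j => ∑ i ∈ S, a i j) s = ∑ i ∈ S, eP Λ K (a i) s := by
  unfold eP
  rw [Finset.sum_comm]
  apply Finset.sum_congr rfl
  intro j _; rw [Finset.sum_mul]

theorem uM_bounds (θ Q : ℝ) (L : ℕ) (hθ : 1 < θ) : ∃ M : ℕ, 1 ≤ M ∧ ∃ C, 0 < C ∧
    ∀ Λ m m' K, Blk θ Q L Λ m m' →
      MB Λ K 0 C (fun j => uM M Λ m m' K (Λ j)) ∧
      ∀ a s, 0 ≤ s → ‖eP Λ K (fun j => ((uM M Λ m m' K (Λ j) * gM (Λ m) (Λ j) : ℝ) : ℂ) * a j) s‖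
        ≤ C * DK (Λ m) (eP Λ K a) * Real.exp (Λ m * s) := by
  obtain ⟨M0, hM0⟩ := pow_unbounded_of_one_lt 18 hθ
  obtain ⟨CH, hCH, hH⟩ := hiM_MB θ Q L hθ
  set M := M0 + 2 with hM
  have hM1 : 1 ≤ M := by omega
  set C1 : ℝ := (3 ^ M + 16 * 4 ^ M) * CH with hC1
  have hC1p : 0 < C1 := by positivity
  refine ⟨M, hM1, C1 * (1 + 2 * Real.exp 1), by positivity, ?_⟩
  intro Λ m m' K hB
  have hℓ := hB.pos m
  set ℓ := Λ m with hℓd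
  have him : ∀ i ∈ Finset.range m, Λ i ≤ ℓ := fun i hi => hB.mono (Finset.mem_range.1 hi).le
  -- the pieces
  have hfirst : ∀ b, 0 ≤ b → b ≤ ℓ → MB Λ K b (3 ^ M * CH)
      (fun j => hpM M ℓ (Λ j) ^ M * hiM Λ m' K (Λ j)) := by
    intro b h0 h1
    exact ((hp_MB M Λ hB.pos K hℓ h1).pow (by norm_num) M).mul (hH Λ m m' K hB b h0 h1) hCH.le
  set ci : ℕ → ℝ := fun i => 8 * (4 * (Λ i / ℓ)) ^ M * 9 ^ (m - (i + 1)) * CH with hci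
  have hci0 : ∀ i, 0 ≤ ci i := fun i => by have := hB.pos i; simp only [hci]; positivity
  have hterm : ∀ i ∈ Finset.range m, ∀ b, 0 ≤ b → b ≤ Λ i → MB Λ K b (ci i)
      (fun j => (hpM M ℓ (Λ j) ^ M * etaM M Λ i (Λ j)) *
        (∏ k ∈ Finset.Ico (i + 1) m, (1 - etaM M Λ k (Λ j))) * hiM Λ m' K (Λ j)) := by
    intro i hi b h0 h1
    have p1 := hp_eta_MB M hM1 Λ hB.pos K i h1 (him i hi)
    have p2 : MB Λ K b (9 ^ (m - (i + 1)))
        (fun j => ∏ k ∈ Finset.Ico (i + 1) m, (1 - etaM M Λ k (Λ j))) := by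
      have := MB.prod (Λ := Λ) (K := K) (b := b) (Finset.Ico (i + 1) m) (c := fun _ => 9)
        (m := fun k j => 1 - etaM M Λ k (Λ j)) (fun k hk => eta_MB M hM1 Λ hB.pos K k
          (h1.trans (hB.mono (by have := (Finset.mem_Ico.1 hk).1; omega)))) (fun _ _ => by norm_num)
      simpa using this
    exact (p1.mul p2 (by positivity)).mul (hH Λ m m' K hB b h0 (h1.trans (him i hi))) hCH.le
  have hsum : ∑ i ∈ Finset.range m, ci i * (ℓ / Λ i) ^ 2 ≤ 16 * 4 ^ M * CH := by
    have : ∀ i ∈ Finset.range m, ci i * (ℓ / Λ i) ^ 2 ≤ 8 * 4 ^ M * CH * (1 / 2) ^ (m - i) := by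
      intro i hi
      have hpi := hB.pos i
      have him' := Finset.mem_range.1 hi
      have hl := hB.low i him'
      have e1 : Λ i / ℓ ≤ (θ ^ (m - i))⁻¹ := by
        rw [div_le_iff₀ hℓ, le_inv_mul_iff₀ (by positivity)]; exact hl
      have e2 : (Λ i / ℓ) ^ M0 ≤ (1 / 18) ^ (m - i) := by
        calc (Λ i / ℓ) ^ M0 ≤ ((θ ^ (m - i))⁻¹) ^ M0 := by gcongr
          _ = ((θ ^ M0)⁻¹) ^ (m - i) := by rw [inv_pow, inv_pow, ← pow_mul, ← pow_mul, mul_comm]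
          _ ≤ _ := by
            gcongr
            rw [inv_le_comm₀ (by positivity) (by norm_num)]; norm_num; linarith
      calc ci i * (ℓ / Λ i) ^ 2 = 8 * 4 ^ M * CH * ((Λ i / ℓ) ^ M0 * 9 ^ (m - (i + 1))) := by
            simp only [hci, hM, mul_pow, pow_add, div_pow]; field_simp
        _ ≤ 8 * 4 ^ M * CH * ((1 / 18) ^ (m - i) * 9 ^ (m - i)) := by
            gcongr
            · norm_num
            · omega
        _ = _ := by rw [← mul_pow]; norm_num
    refine (Finset.sum_le_sum this).trans ?_
    rw [← Finset.mul_sum]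
    have h2 := sum_range_rev_le (fun p : ℕ => ((1:ℝ) / 2) ^ p)
      (summable_geometric_of_lt_one (by norm_num) (by norm_num)) (fun p => by positivity) m
    rw [tsum_geometric_two] at h2
    have h3 : 0 ≤ 8 * 4 ^ M * CH := by positivity
    nlinarith
  have hsum0 : ∑ i ∈ Finset.range m, ci i ≤ 16 * 4 ^ M * CH := by
    refine (Finset.sum_le_sum (fun i hi => ?_)).trans hsum
    have hpi := hB.pos i
    have : 1 ≤ ℓ / Λ i := by rw [le_div_iff₀ hpi]; linarith [him i hi]
    exact le_mul_of_one_le_right (hci0 i) (one_le_pow₀ this)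
  have hci00 : 0 ≤ ∑ i ∈ Finset.range m, ci i := Finset.sum_nonneg (fun i _ => hci0 i)
  constructor
  · have h1 := hfirst 0 le_rfl hℓ.le
    have h2 := MB.sum (Finset.range m) (fun i hi => hterm i hi 0 le_rfl (hB.pos i).le)
    have h3 := h1.sub h2 hci00
    refine (h3.mono ?_).congr (fun j _ => (uM_tele M Λ m m' K (Λ j)).symm)
    calc _ ≤ C1 := by rw [hC1]; linarith
      _ ≤ _ := le_mul_of_one_le_right hC1p.le (by have := Real.exp_pos 1; linarith)
  · intro a s hs
    set X := 2 * Real.exp 1 * DK ℓ (eP Λ K a) with hX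
    have hD0 : 0 ≤ DK ℓ (eP Λ K a) := DK_nonneg hℓ _
    have hX0 : 0 ≤ X := by positivity
    set g : ℕ → ℂ := fun j => (gM ℓ (Λ j) : ℂ) * a j with hg
    have e : eP Λ K (fun j => ((uM M Λ m m' K (Λ j) * gM ℓ (Λ j) : ℝ) : ℂ) * a j) s
        = eP Λ K (fun j => ((hpM M ℓ (Λ j) ^ M * hiM Λ m' K (Λ j) : ℝ) : ℂ) * g j) s
        - ∑ i ∈ Finset.range m, eP Λ K (fun j => (((hpM M ℓ (Λ j) ^ M * etaM M Λ i (Λ j)) *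
        (∏ k ∈ Finset.Ico (i + 1) m, (1 - etaM M Λ k (Λ j))) * hiM Λ m' K (Λ j) : ℝ) : ℂ) * g j) s := by
      rw [← eP_sum, sub_eq_add_neg, ← neg_one_mul, ← eP_smul, ← eP_add]
      apply eP_congr
      intro j _
      rw [uM_tele, ← hℓd, ← Finset.sum_mul (a := g j), ← Complex.ofReal_sum, Complex.ofReal_mul,
        Complex.ofReal_sub]
      simp only [hg]
      ring
    rw [e]
    have b1 := hfirst ℓ hℓ.le le_rfl g X hX0 (fun s hs => by
      have := gM_bound Λ hB.pos K a hℓ le_rfl hs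
      rwa [div_self hℓ.ne', one_pow, mul_one] at this) s hs
    have b2 : ∀ i ∈ Finset.range m, ‖eP Λ K (fun j => (((hpM M ℓ (Λ j) ^ M * etaM M Λ i (Λ j)) *
        (∏ k ∈ Finset.Ico (i + 1) m, (1 - etaM M Λ k (Λ j))) * hiM Λ m' K (Λ j) : ℝ) : ℂ) * g j) s‖
        ≤ (ci i * (ℓ / Λ i) ^ 2) * (X * Real.exp (ℓ * s)) := by
      intro i hi
      have hpi := hB.pos i
      have := hterm i hi (Λ i) hpi.le le_rfl g (X * (ℓ / Λ i) ^ 2) (by positivity)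
        (fun s hs => gM_bound Λ hB.pos K a hpi (him i hi) hs) s hs
      refine this.trans ?_
      have h3 : Real.exp (Λ i * s) ≤ Real.exp (ℓ * s) := by
        apply Real.exp_le_exp.2; exact mul_le_mul_of_nonneg_right (him i hi) hs
      have := hci0 i
      calc _ ≤ ci i * (X * (ℓ / Λ i) ^ 2) * Real.exp (ℓ * s) := by gcongr
        _ = _ := by ring
    calc _ ≤ 3 ^ M * CH * X * Real.exp (ℓ * s) +
          ∑ i ∈ Finset.range m, (ci i * (ℓ / Λ i) ^ 2) * (X * Real.exp (ℓ * s)) := by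
          refine (norm_sub_le _ _).trans (add_le_add b1 ((norm_sum_le _ _).trans (Finset.sum_le_sum b2)))
      _ ≤ 3 ^ M * CH * X * Real.exp (ℓ * s) + (16 * 4 ^ M * CH) * (X * Real.exp (ℓ * s)) := by
          rw [← Finset.sum_mul]; gcongr
      _ = C1 * (2 * Real.exp 1) * DK ℓ (eP Λ K a) * Real.exp (ℓ * s) := by rw [hC1, hX]; ring
      _ ≤ _ := by gcongr; linarith

theorem Y_exists (Λ : ℕ → ℝ) (K : ℕ) {c2 u0 : ℝ} (U : ℕ → ℝ) (hU : MB Λ K 0 c2 U) (hc2 : 0 ≤ c2)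
    (hu0 : 0 < u0) (S : Finset ℕ) (hS : ∀ i ∈ S, u0 ≤ U i) :
    ∃ Y : ℕ → ℝ, MB Λ K 0 (S.card * (1 + c2 / u0) ^ S.card / u0) Y ∧
      ∀ j, U j * Y j = 1 - ∏ i ∈ S, (1 - U j / U i) := by
  induction S using Finset.induction_on with
  | empty => exact ⟨fun _ => 0, by simpa using MB.const Λ K 0 0, by simp⟩
  | insert i S hi ih =>
    obtain ⟨Y, hY, hYe⟩ := ih (fun k hk => hS k (Finset.mem_insert_of_mem hk))
    have hui := hS i (Finset.mem_insert_self i S)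
    have hui0 : 0 < U i := hu0.trans_le hui
    set cY : ℝ := S.card * (1 + c2 / u0) ^ S.card / u0 with hcY
    have hcY0 : 0 ≤ cY := by positivity
    have hinv : |(U i)⁻¹| ≤ u0⁻¹ := by
      rw [abs_of_pos (by positivity)]
      exact inv_anti₀ hu0 hui
    have h1 := (hY.add (MB.const Λ K 0 (U i)⁻¹)).sub ((hU.mul hY hcY0).smul (by positivity) (U i)⁻¹)
      (by positivity)
    refine ⟨_, h1.mono ?_, ?_⟩
    · rw [Finset.card_insert_of_notMem hi]
      have hB : 1 ≤ (1 + c2 / u0) ^ (S.card + 1) := one_le_pow₀ (by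
        have : 0 ≤ c2 / u0 := by positivity
        linarith)
      calc cY + |(U i)⁻¹| + |(U i)⁻¹| * (c2 * cY) ≤ cY + u0⁻¹ + u0⁻¹ * (c2 * cY) := by gcongr
        _ = cY * (1 + c2 / u0) + 1 * u0⁻¹ := by ring
        _ ≤ cY * (1 + c2 / u0) + (1 + c2 / u0) ^ (S.card + 1) * u0⁻¹ := by gcongr
        _ = _ := by rw [hcY]; push_cast; ring
    · intro j
      rw [Finset.prod_insert hi]
      have h2 : ∏ k ∈ S, (1 - U j / U k) = 1 - U j * Y j := by rw [hYe]; ring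
      rw [h2]
      field_simp
      ring

theorem uM_zero {θ Q : ℝ} {L : ℕ} {Λ : ℕ → ℝ} {m m' : ℕ} (hB : Blk θ Q L Λ m m') (M K j : ℕ) (hj : j < K)
    (h : ¬ (m ≤ j ∧ j < m')) : uM M Λ m m' K (Λ j) = 0 := by
  unfold uM
  by_cases h1 : j < m
  · have : ∏ i ∈ Finset.range m, (1 - etaM M Λ i (Λ j)) = 0 := by
      apply Finset.prod_eq_zero (Finset.mem_range.2 h1)
      unfold etaM
      have := hB.pos j
      rw [show Λ j + ((M:ℝ) + 1) * Λ j = ((M:ℝ) + 2) * Λ j by ring, div_self (by positivity)]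
      simp
    rw [this]; ring
  · have : hiM Λ m' K (Λ j) = 0 := by
      unfold hiM
      apply Finset.prod_eq_zero (i := j) (Finset.mem_Ico.2 ⟨by omega, hj⟩)
      simp
    rw [this]; ring

theorem block_bound (θ Q : ℝ) (L : ℕ) (hθ : 1 < θ) (hQ : 0 ≤ Q) (hL : 1 ≤ L) :
    ∃ C, 0 < C ∧ ∀ Λ m m' K, Blk θ Q L Λ m m' → ∀ (a : ℕ → ℂ) s, 0 ≤ s →
      ‖eP Λ K (fun j => if m ≤ j ∧ j < m' then a j else 0) s‖ ≤
        C * DK (Λ m) (eP Λ K a) * Real.exp (-(Λ m * s / (4 * L ^ 2))) := by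
  obtain ⟨M, hM, C, hC, hU⟩ := uM_bounds θ Q L hθ
  obtain ⟨c1, hc1, hlow⟩ := low_lb θ Q L M hM hθ
  obtain ⟨c3, hc3, hhi⟩ := hiM_lb θ Q L hθ
  set h0 : ℝ := 1 / (1 + 2 * ((M : ℝ) + 1)) with hh0
  set u0 : ℝ := h0 ^ M * c1 * c3 * (Real.exp (-Q) * (1 / (1 + Q))) with hu0d
  have hh0p : 0 < h0 := by positivity
  have hu0 : 0 < u0 := by positivity
  set CY : ℝ := L * (1 + C / u0) ^ L / u0 with hCY
  have hL' : (0:ℝ) < L := by exact_mod_cast hL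
  have hCYp : 0 < CY := by positivity
  refine ⟨CY * (C * Real.exp (4 * L ^ 2 + 1)) * Real.exp 1, by positivity, ?_⟩
  intro Λ m m' K hB a
  obtain ⟨hU1, hU2⟩ := hU Λ m m' K hB
  have hℓ := hB.pos m
  set S := Finset.Ico m m' with hS
  have hmem : ∀ j, (m ≤ j ∧ j < m') ↔ j ∈ S := fun j => by rw [hS, Finset.mem_Ico]
  have hScard : S.card ≤ L := by have := hB.len; simp [hS]; omega
  have hSΛ : ∀ i ∈ S, Λ m ≤ Λ i := fun i hi => hB.mono ((hmem i).2 hi).1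
  set U : ℕ → ℝ := fun j => uM M Λ m m' K (Λ j) * gM (Λ m) (Λ j) with hUd
  set D := DK (Λ m) (eP Λ K a) with hD
  have hD0 : 0 ≤ D := DK_nonneg hℓ _
  have hUS : ∀ i ∈ S, u0 ≤ U i := by
    intro i hi
    have hmi := (hmem i).2 hi
    have hz := hSΛ i hi
    have hzQ := hB.blk i hmi.1 hmi.2
    have hzp := hB.pos i
    simp only [hUd, uM, hu0d]
    have k1 : h0 ≤ hpM M (Λ m) (Λ i) := by
      unfold hpM; rw [hh0, div_le_div_iff₀ (by positivity) (by positivity)]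
      have : 0 ≤ (M:ℝ) + 1 := by positivity
      nlinarith
    have k2 := hlow Λ m m' hB (Λ i) hz
    have k3 := hhi Λ m m' K hB i hmi.1 hmi.2
    have k4 : Real.exp (-Q) * (1 / (1 + Q)) ≤ gM (Λ m) (Λ i) := by
      unfold gM
      gcongr ?_ * ?_
      · apply Real.exp_le_exp.2
        apply neg_le_neg
        rw [mul_one_div, div_le_iff₀ hℓ]; exact hzQ
      · rw [div_le_div_iff₀ (by positivity) (by positivity)]
        nlinarith
    have hh0' := hh0p.le
    have hc1' := hc1.le
    have hc3' := hc3.le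
    gcongr
    · exact mul_nonneg (mul_nonneg (pow_nonneg (hh0p.le.trans k1) _) (hc1.le.trans k2)) (hc3.le.trans k3)
    · exact mul_nonneg (pow_nonneg (hh0p.le.trans k1) _) (hc1.le.trans k2)
    · exact pow_nonneg (hh0p.le.trans k1) _
  have hMBU : MB Λ K 0 C U := by
    have g1 := (MB.shift Λ K 0 (h := 1 / Λ m) (by positivity)).mul
      (MB.res Λ hB.pos K (b := 0) (B := Λ m) hℓ hℓ) (by simp; positivity)
    have := hU1.mul g1 (by rw [sub_zero, div_self hℓ.ne']; positivity)
    refine (this.mono ?_).congr (fun j _ => rfl)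
    rw [sub_zero, div_self hℓ.ne']; simp
  obtain ⟨Y, hY, hYe⟩ := Y_exists Λ K U hMBU hC.le hu0 S hUS
  have hY' : MB Λ K 0 CY Y := by
    refine hY.mono ?_
    rw [hCY]
    have : 1 ≤ 1 + C / u0 := by have : 0 < C / u0 := by positivity
                                linarith
    gcongr
  set v : ℕ → ℂ := fun j => if m ≤ j ∧ j < m' then (U j : ℂ) * a j else 0 with hv
  have hvS : ∀ j, j ∉ S → v j = 0 := fun j hj => by simp only [hv]; rw [if_neg]; rwa [hmem]
  have hve : ∀ s, eP Λ K v s = eP Λ K (fun j => (U j : ℂ) * a j) s := by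
    intro s
    apply eP_congr
    intro j hj
    simp only [hv]
    split_ifs with h
    · rfl
    · simp only [hUd]; rw [uM_zero hB M K j hj h]; simp
  have hvb : ∀ s, 0 ≤ s → ‖eP Λ K v s‖ ≤ (C * Real.exp (4 * L ^ 2 + 1)) * D * Real.exp (0 * s) := by
    intro s hs
    have := eP_decay Λ K L hL hℓ S hScard v hvS hSΛ (D := C * D * Real.exp (4 * L ^ 2)) (fun s hs hs' => by
      rw [hve]
      refine (hU2 a s hs).trans ?_
      rw [le_div_iff₀ hℓ] at hs'
      have h9 : Real.exp (Λ m * s) ≤ Real.exp (4 * L ^ 2) := Real.exp_le_exp.2 (by linarith)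
      gcongr) s hs
    refine this.trans ?_
    have h1 : Real.exp (1 - Λ m * s / (4 * L ^ 2)) ≤ Real.exp 1 := by
      apply Real.exp_le_exp.2
      have : 0 ≤ Λ m * s / (4 * L ^ 2) := by positivity
      linarith
    rw [zero_mul, Real.exp_zero, mul_one, Real.exp_add]
    calc _ ≤ C * D * Real.exp (4 * L ^ 2) * Real.exp 1 := by gcongr
      _ = _ := by ring
  have hfin : ∀ s, 0 ≤ s → ‖eP Λ K (fun j => if m ≤ j ∧ j < m' then a j else 0) s‖ ≤
      CY * ((C * Real.exp (4 * L ^ 2 + 1)) * D) := by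
    intro s hs
    have := hY' v _ (by positivity) hvb s hs
    rw [zero_mul, Real.exp_zero, mul_one] at this
    rw [← eP_congr (a := fun j => (Y j : ℂ) * v j)]
    · exact this
    · intro j hj
      simp only [hv]
      split_ifs with h
      · have h1 := hYe j
        rw [Finset.prod_eq_zero ((hmem j).1 h) (by
          rw [div_self (hu0.trans_le (hUS j ((hmem j).1 h))).ne']; ring), sub_zero] at h1
        rw [← mul_assoc, ← Complex.ofReal_mul, mul_comm (Y j), h1]; simp
      · simp
  intro s hs
  have := eP_decay Λ K L hL hℓ S hScard (fun j => if m ≤ j ∧ j < m' then a j else 0)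
    (fun j hj => by rw [if_neg]; rwa [hmem]) hSΛ (fun s hs _ => hfin s hs) s hs
  refine this.trans (le_of_eq ?_)
  rw [sub_eq_add_neg, Real.exp_add 1]; ring

theorem exists_block {n : ℕ → ℕ} (h0 : n 0 = 0) (hn : StrictMono n) (j : ℕ) :
    ∃ k, n k ≤ j ∧ j < n (k + 1) := by
  induction j with
  | zero => exact ⟨0, h0.le, by have := hn (Nat.lt_succ_self 0); simp only [Nat.succ_eq_add_one] at this; omega⟩
  | succ j ih =>
    obtain ⟨k, h1, h2⟩ := ih
    by_cases h : j + 1 < n (k + 1)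
    · exact ⟨k, by omega, h⟩
    · exact ⟨k + 1, by omega, by have := hn (Nat.lt_succ_self (k + 1)); simp only [Nat.succ_eq_add_one] at this; omega⟩

theorem initial_ratio (Γ : ℕ → ℝ) (hpos : ∀ j, 0 < Γ j) (hmono : StrictMono Γ) (J : ℕ) :
    ∃ q : ℝ, 1 < q ∧ ∀ m < J, q * Γ m ≤ Γ (m + 1) := by
  induction J with
  | zero => exact ⟨2, by norm_num, by simp⟩
  | succ J ih =>
    obtain ⟨q, hq, h⟩ := ih
    have hJ : 1 < Γ (J + 1) / Γ J := by
      rw [lt_div_iff₀ (hpos J), one_mul]; exact hmono (Nat.lt_succ_self J)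
    refine ⟨min q (Γ (J + 1) / Γ J), lt_min hq hJ, ?_⟩
    intro m hm
    rcases Nat.lt_succ_iff_lt_or_eq.1 hm with h1 | h1
    · exact (mul_le_mul_of_nonneg_right (min_le_left _ _) (hpos m).le).trans (h m h1)
    · subst h1
      exact (mul_le_mul_of_nonneg_right (min_le_right _ _) (hpos m).le).trans
        (by rw [div_mul_cancel₀ _ (hpos m).ne'])

theorem initial_ratio_ub (Γ : ℕ → ℝ) (hpos : ∀ j, 0 < Γ j) (J : ℕ) :
    ∃ q : ℝ, 1 < q ∧ ∀ m < J, Γ (m + 1) ≤ q * Γ m := by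
  induction J with
  | zero => exact ⟨2, by norm_num, by simp⟩
  | succ J ih =>
    obtain ⟨q, hq, h⟩ := ih
    refine ⟨max q (Γ (J + 1) / Γ J), lt_max_of_lt_left hq, ?_⟩
    intro m hm
    rcases Nat.lt_succ_iff_lt_or_eq.1 hm with h1 | h1
    · exact (h m h1).trans (mul_le_mul_of_nonneg_right (le_max_left _ _) (hpos m).le)
    · subst h1
      refine le_trans ?_ (mul_le_mul_of_nonneg_right (le_max_right _ _) (hpos m).le)
      rw [div_mul_cancel₀ _ (hpos m).ne']

theorem exists_root {q : ℝ} (hq : 1 < q) {L : ℕ} (hL : 1 ≤ L) : ∃ θ : ℝ, 1 < θ ∧ θ ^ L = q := by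
  refine ⟨q ^ (1 / (L : ℝ)), Real.one_lt_rpow hq (by positivity), ?_⟩
  rw [← Real.rpow_natCast, ← Real.rpow_mul (by linarith), one_div_mul_cancel (by positivity), Real.rpow_one]

theorem blocks_exist (Γ : ℕ → ℝ) (hpos : ∀ j, 0 < Γ j) (hmono : StrictMono Γ) (Qr : ℝ)
    (hQr : ∀ j, Γ (j + 1) ≤ Qr * Γ j) (q : ℝ) (hq : 1 < q) (J L : ℕ) (hL : 1 ≤ L)
    (hqJ : ∀ j, J ≤ j → q * Γ j ≤ Γ (j + L)) (j0 : ℕ) :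
    ∃ θ Q q1 : ℝ, ∃ n' : ℕ → ℕ, 1 < θ ∧ 0 ≤ Q ∧ 1 < q1 ∧ n' 0 = 0 ∧ StrictMono n' ∧
      (∀ k, n' k < j0 → n' (k + 1) = n' k + 1) ∧ (∀ k, Blk θ Q L Γ (n' k) (n' (k + 1))) ∧
      ∀ k, q1 * Γ (n' k) ≤ Γ (n' (k + 1)) := by
  obtain ⟨ρ, hρ, hρL⟩ := exists_root hq hL
  obtain ⟨q0, hq0, hq0J⟩ := initial_ratio Γ hpos hmono (max J j0)
  set q1 := min ρ q0 with hq1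
  have hq11 : 1 < q1 := lt_min hρ hq0
  have hex : ∀ m, ∃ m', m < m' ∧ m' ≤ m + L ∧ q1 * Γ (m' - 1) ≤ Γ m' ∧ (m < j0 → m' = m + 1) := by
    intro m
    by_cases hm : m < max J j0
    · refine ⟨m + 1, by omega, by omega, ?_, fun _ => rfl⟩
      exact (mul_le_mul_of_nonneg_right (min_le_right _ _) (hpos _).le).trans (hq0J m hm)
    · have hmJ : J ≤ m := by have := le_max_left J j0; omega
      have hmj : ¬ m < j0 := by have := le_max_right J j0; omega
      by_contra hcon
      push Not at hcon
      have h1 : ∀ i, i ≤ L → 1 ≤ i → Γ (m + i) < ρ ^ i * Γ m := by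
        intro i
        induction i with
        | zero => intro _ h; omega
        | succ i ih =>
          intro hi _
          have h2 := hcon (m + (i + 1)) (by omega) (by omega)
          have h3 : Γ (m + (i + 1)) < q1 * Γ (m + i) := by
            by_contra h4
            push Not at h4
            exact absurd (h2 (by rw [show m + (i + 1) - 1 = m + i by omega]; exact h4)).1 hmj
          have h5 : q1 * Γ (m + i) ≤ ρ * Γ (m + i) :=
            mul_le_mul_of_nonneg_right (min_le_left _ _) (hpos _).le
          rcases Nat.eq_zero_or_pos i with h6 | h6
          · subst h6; simp at *; linarith
          · have h7 := ih (by omega) h6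
            rw [pow_succ]
            nlinarith
      have h2 := h1 L le_rfl hL
      rw [hρL] at h2
      linarith [hqJ m hmJ]
  choose nx hx1 hx2 hx3 hx4 using hex
  obtain ⟨θ, hθ, hθL⟩ := exists_root hq11 hL
  set n' : ℕ → ℕ := fun k => Nat.rec 0 (fun _ x => nx x) k with hn'
  have hs : ∀ k, n' (k + 1) = nx (n' k) := fun k => rfl
  have hn0 : n' 0 = 0 := rfl
  clear_value n'
  have hnm : StrictMono n' := strictMono_nat_of_lt_succ (fun k => by rw [hs]; exact hx1 _)
  have hQr1 : 1 ≤ Qr := by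
    have h1 := hQr 0
    have h2 := hmono (Nat.lt_succ_self 0)
    simp only [Nat.succ_eq_add_one] at h2
    have h3 := hpos 0
    by_contra h4
    push Not at h4
    nlinarith
  have hstep : ∀ k i, n' k ≤ i → i < n' (k + 1) → q1 * Γ i ≤ Γ (n' (k + 1)) := by
    intro k i h1 h2
    rw [hs] at *
    refine le_trans ?_ (hx3 (n' k))
    exact mul_le_mul_of_nonneg_left (hmono.monotone (by omega)) (by linarith)
  have hθpow : ∀ e, e ≤ L → θ ^ e ≤ q1 := fun e he => by
    rw [← hθL]; exact pow_le_pow_right₀ hθ.le he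
  have hlow : ∀ k i, i < n' k → θ ^ (n' k - i) * Γ i ≤ Γ (n' k) := by
    intro k
    induction k with
    | zero => intro i hi; omega
    | succ k ih =>
      have hlen : n' (k + 1) ≤ n' k + L := by rw [hs]; exact hx2 _
      have case1 : ∀ i, n' k ≤ i → i < n' (k + 1) → θ ^ (n' (k + 1) - i) * Γ i ≤ Γ (n' (k + 1)) := by
        intro i h1 h2
        exact (mul_le_mul_of_nonneg_right (hθpow _ (by omega)) (hpos i).le).trans (hstep k i h1 h2)
      intro i hi
      by_cases h : n' k ≤ i
      · exact case1 i h hi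
      · push Not at h
        have hlt := hnm (Nat.lt_succ_self k)
        simp only [Nat.succ_eq_add_one] at hlt
        rw [show n' (k + 1) - i = (n' (k + 1) - n' k) + (n' k - i) by omega, pow_add, mul_assoc]
        exact (mul_le_mul_of_nonneg_left (ih i h) (by positivity)).trans (case1 _ le_rfl hlt)
  refine ⟨θ, Qr ^ L, q1, n', hθ, by positivity, hq11, hn0, hnm, fun k hk => by rw [hs]; exact hx4 _ hk, ?_, ?_⟩
  · intro k
    have hlt := hnm (Nat.lt_succ_self k)
    simp only [Nat.succ_eq_add_one] at hlt
    have hlen : n' (k + 1) ≤ n' k + L := by rw [hs]; exact hx2 _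
    refine ⟨hpos, hmono.monotone, hlt, hlen, hlow k, ?_, ?_⟩
    · intro i h1 h2
      have : ∀ e, Γ (n' k + e) ≤ Qr ^ e * Γ (n' k) := by
        intro e
        induction e with
        | zero => simp
        | succ e ih =>
          rw [← add_assoc, pow_succ]
          have := hQr (n' k + e)
          nlinarith
      obtain ⟨e, rfl⟩ := Nat.exists_eq_add_of_le h1
      refine (this e).trans (mul_le_mul_of_nonneg_right ?_ (hpos _).le)
      exact pow_le_pow_right₀ hQr1 (by omega)
    · intro j hj i h1 h2
      obtain ⟨k', hk1, hk2⟩ := exists_block hn0 hnm j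
      have hkk : k + 1 ≤ k' := by
        by_contra h
        have : n' (k' + 1) ≤ n' (k + 1) := hnm.monotone (by omega)
        omega
      have hlen' : n' (k' + 1) ≤ n' k' + L := by rw [hs]; exact hx2 _
      have hle : n' (k + 1) ≤ n' k' := hnm.monotone hkk
      have e1 : θ ^ (n' k' - n' (k + 1)) * Γ (n' (k + 1)) ≤ Γ (n' k') := by
        rcases hle.lt_or_eq with h | h
        · exact hlow k' _ h
        · rw [← h]; simp
      calc θ ^ (j - n' (k + 1) + 1) * Γ i ≤ θ ^ ((n' k' - n' (k + 1)) + L) * Γ i := by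
            apply mul_le_mul_of_nonneg_right _ (hpos i).le
            exact pow_le_pow_right₀ hθ.le (by omega)
        _ = θ ^ (n' k' - n' (k + 1)) * (q1 * Γ i) := by rw [pow_add, hθL]; ring
        _ ≤ θ ^ (n' k' - n' (k + 1)) * Γ (n' (k + 1)) := by
            gcongr; exact hstep k i h1 h2
        _ ≤ Γ (n' k') := e1
        _ ≤ Γ j := hmono.monotone hk1
  · intro k
    have hlt := hnm (Nat.lt_succ_self k)
    exact hstep k _ le_rfl hlt

theorem ql_ratio {Λ : ℕ → ℝ} {n : ℕ → ℕ} {N : ℕ} (h : IsQuasiLacunary Λ n N) :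
    ∃ q : ℝ, 1 < q ∧ ∃ J, ∀ j, J ≤ j → q * Λ j ≤ Λ (j + 2 * N) := by
  obtain ⟨q, hq, hev⟩ := h.ratio
  obtain ⟨k0, hk0⟩ := eventually_atTop.1 hev
  refine ⟨q, hq, n k0, ?_⟩
  intro j hj
  obtain ⟨k, h1, h2⟩ := exists_block h.n_zero h.n_mono j
  have hk : k0 < k + 1 := by
    by_contra hc
    have := h.n_mono.monotone (show k + 1 ≤ k0 by omega)
    omega
  have b1 := h.block_le k
  have b2 := h.block_le (k + 1)
  have e := hk0 (k + 1) hk.le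
  have m1 : Λ j ≤ Λ (n (k + 1)) := h.mono.monotone h2.le
  have m2 : Λ (n (k + 1 + 1)) ≤ Λ (j + 2 * N) := h.mono.monotone (by omega)
  nlinarith

theorem ql_ub {Λ : ℕ → ℝ} {n : ℕ → ℕ} {N : ℕ} (h : IsQuasiLacunary Λ n N) (hs : IsSubgeometric Λ n) :
    ∃ q : ℝ, 1 < q ∧ ∀ j, Λ (j + 1) ≤ q * Λ j := by
  obtain ⟨q, hq, hev⟩ := hs
  obtain ⟨k0, hk0⟩ := eventually_atTop.1 hev
  obtain ⟨q2, hq2, h2⟩ := initial_ratio_ub Λ h.pos (n k0)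
  refine ⟨max q q2, lt_max_of_lt_left hq, ?_⟩
  intro j
  by_cases hj : j < n k0
  · exact (h2 j hj).trans (mul_le_mul_of_nonneg_right (le_max_right _ _) (h.pos j).le)
  · obtain ⟨k, h1, h3⟩ := exists_block h.n_zero h.n_mono j
    have hk : k0 < k + 1 := by
      by_contra hc
      have := h.n_mono.monotone (show k + 1 ≤ k0 by omega)
      omega
    have e := hk0 k (by omega)
    have m1 : Λ (j + 1) ≤ Λ (n (k + 1)) := h.mono.monotone h3
    have m2 : Λ (n k) ≤ Λ j := h.mono.monotone h1
    have m3 := mul_le_mul_of_nonneg_right (le_max_left q q2) (h.pos j).le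
    nlinarith

theorem ql_tendsto {Λ : ℕ → ℝ} {n : ℕ → ℕ} {N : ℕ} (h : IsQuasiLacunary Λ n N) :
    Tendsto Λ atTop atTop := by
  have h1 := h.sum_inv.tendsto_atTop_zero
  have h2 : Tendsto (fun k => 1 / Λ k) atTop (nhdsWithin 0 (Ioi 0)) :=
    tendsto_nhdsWithin_iff.2 ⟨h1, Eventually.of_forall (fun k => by
      have := h.pos k; simp only [mem_Ioi]; positivity)⟩
  have h3 := h2.inv_tendsto_nhdsGT_zero
  refine h3.congr (fun k => ?_)
  simp

theorem eP_blocks (Γ : ℕ → ℝ) (K : ℕ) (a : ℕ → ℂ) (n' : ℕ → ℕ) (h0 : n' 0 = 0) (hn : StrictMono n') (s : ℝ) :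
    eP Γ K a s = ∑ k ∈ Finset.range K,
      eP Γ K (fun j => if n' k ≤ j ∧ j < n' (k + 1) then a j else 0) s := by
  rw [← eP_sum]
  apply eP_congr
  intro j hj
  obtain ⟨k, h1, h2⟩ := exists_block h0 hn j
  rw [Finset.sum_eq_single k]
  · rw [if_pos ⟨h1, h2⟩]
  · intro k' _ hk'
    rw [if_neg]
    rintro ⟨h3, h4⟩
    apply hk'
    have a1 : ¬ k + 1 ≤ k' := fun h => by have := hn.monotone h; omega
    have a2 : ¬ k' + 1 ≤ k := fun h => by have := hn.monotone h; omega
    omega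
  · intro hk
    exfalso; apply hk
    have := hn.id_le k
    simp only [id] at this
    exact Finset.mem_range.2 (by omega)

theorem pointwise_bound {Λ : ℕ → ℝ} {n : ℕ → ℕ} {N : ℕ} (h : IsQuasiLacunary Λ n N)
    (hsub : IsSubgeometric Λ n) {σ : ℝ} (hσ : 0 < σ) :
    ∃ (ℓ : ℕ → ℝ) (q1 C c1 : ℝ), 0 < ℓ 0 ∧ 1 < q1 ∧ 0 < C ∧ 0 < c1 ∧
      (∀ k, q1 * ℓ k ≤ ℓ (k + 1)) ∧
      ∀ K a s, 0 ≤ s → ‖eP Λ K a s‖ ≤ C * ∑ k ∈ Finset.range K,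
        DK (ℓ k) (eP (fun j => Λ j + σ) K a) * Real.exp (-(max (c1 * ℓ k) (Λ 0) * s)) := by
  obtain ⟨q, hq, J, hJ⟩ := ql_ratio h
  obtain ⟨Qr, hQr, hQ⟩ := ql_ub h hsub
  have htend := ql_tendsto h
  have hL : 1 ≤ 2 * N := by have := h.one_le_N; omega
  set L := 2 * N with hLd
  set Γ : ℕ → ℝ := fun j => Λ j + σ with hΓ
  have hΓp : ∀ j, 0 < Γ j := fun j => by have := h.pos j; simp only [hΓ]; positivity
  have hΓm : StrictMono Γ := fun i j hij => by have := h.mono hij; simp only [hΓ]; linarith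
  have hΓQ : ∀ j, Γ (j + 1) ≤ Qr * Γ j := fun j => by have := hQ j; simp only [hΓ]; nlinarith
  obtain ⟨J1, hJ1⟩ := eventually_atTop.1 (htend.eventually_ge_atTop σ)
  have hΓq : ∀ j, max J J1 ≤ j → (1 + q) / 2 * Γ j ≤ Γ (j + L) := fun j hj => by
    have h1 := hJ j ((le_max_left _ _).trans hj)
    have h2 := hJ1 j ((le_max_right _ _).trans hj)
    simp only [hΓ]; nlinarith
  set c : ℝ := 1 / (4 * (L:ℝ) ^ 2) with hc
  have hL' : (0:ℝ) < L := by exact_mod_cast hL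
  have hcp : 0 < c := by positivity
  obtain ⟨j0, hj0⟩ := eventually_atTop.1 (htend.eventually_ge_atTop (2 * (σ + Λ 0) / c))
  obtain ⟨θ, Q, q1, n', hθ, hQ0, hq1, hn0, hnm, hsing, hblk, hlac⟩ :=
    blocks_exist Γ hΓp hΓm Qr hΓQ ((1 + q) / 2) (by linarith) (max J J1) L hL hΓq j0
  obtain ⟨C, hC, hbb⟩ := block_bound θ Q L hθ hQ0 hL
  have h00 := h.pos 0
  refine ⟨fun k => Γ (n' k), q1, C, min (c / 2) (Λ 0 / (Λ 0 + σ)), hΓp _, hq1, hC,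
    lt_min (by positivity) (by positivity), hlac, ?_⟩
  intro K a s hs
  rw [eP_blocks Λ K a n' hn0 hnm, Finset.mul_sum]
  refine (norm_sum_le _ _).trans (Finset.sum_le_sum ?_)
  intro k _
  set D := DK (Γ (n' k)) (eP Γ K a) with hD
  have hD0 : 0 ≤ D := DK_nonneg (hΓp _) _
  set a' : ℕ → ℂ := fun j => if n' k ≤ j ∧ j < n' (k + 1) then a j else 0 with ha'
  have hΛ0 : Λ 0 ≤ Λ (n' k) := h.mono.monotone (Nat.zero_le _)
  set c1 := min (c / 2) (Λ 0 / (Λ 0 + σ)) with hc1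
  rw [← mul_assoc]
  by_cases hk : n' k < j0
  · have hn1 := hsing k hk
    have e : eP Λ K a' s = ((Real.exp (-(Λ (n' k) * s)) : ℝ) : ℂ) * eP Γ K a' 0 := by
      unfold eP
      rw [Finset.mul_sum]
      apply Finset.sum_congr rfl
      intro j _
      simp only [ha']
      split_ifs with hj
      · have : j = n' k := by omega
        subst this; simp; ring
      · simp
    have hb := hbb Γ _ _ K (hblk k) a 0 le_rfl
    simp only [mul_zero, zero_div, neg_zero, Real.exp_zero, mul_one] at hb
    rw [e, norm_mul, Complex.norm_real, Real.norm_of_nonneg (Real.exp_pos _).le, mul_comm]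
    have hmax : max (c1 * Γ (n' k)) (Λ 0) ≤ Λ (n' k) := by
      refine max_le ?_ hΛ0
      refine (mul_le_mul_of_nonneg_right (min_le_right _ _) (hΓp _).le).trans ?_
      simp only [hΓ]
      rw [div_mul_eq_mul_div, div_le_iff₀ (by positivity)]
      nlinarith
    have : Real.exp (-(Λ (n' k) * s)) ≤ Real.exp (-(max (c1 * Γ (n' k)) (Λ 0) * s)) := by
      apply Real.exp_le_exp.2
      have := mul_le_mul_of_nonneg_right hmax hs
      linarith
    gcongr
  · have e : eP Λ K a' s = ((Real.exp (σ * s) : ℝ) : ℂ) * eP Γ K a' s := by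
      unfold eP
      rw [Finset.mul_sum]
      apply Finset.sum_congr rfl
      intro j _
      have : Real.exp (-(Λ j * s)) = Real.exp (σ * s) * Real.exp (-(Γ j * s)) := by
        rw [← Real.exp_add]; congr 1; simp only [hΓ]; ring
      rw [this]; push_cast; ring
    have hb := hbb Γ _ _ K (hblk k) a s hs
    rw [e, norm_mul, Complex.norm_real, Real.norm_of_nonneg (Real.exp_pos _).le]
    have h1 := hj0 (n' k) (by omega)
    rw [div_le_iff₀ hcp] at h1
    have hg : 2 * (σ + Λ 0) ≤ c * Γ (n' k) := by simp only [hΓ]; nlinarith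
    have hmax : max (c1 * Γ (n' k)) (Λ 0) ≤ c * Γ (n' k) - σ := by
      refine max_le ?_ (by linarith)
      refine (mul_le_mul_of_nonneg_right (min_le_left _ _) (hΓp _).le).trans ?_
      linarith
    calc _ ≤ Real.exp (σ * s) * (C * D * Real.exp (-(Γ (n' k) * s / (4 * L ^ 2)))) := by gcongr
      _ = C * D * Real.exp (-((c * Γ (n' k) - σ) * s)) := by
          rw [show -((c * Γ (n' k) - σ) * s) = σ * s + -(Γ (n' k) * s / (4 * L ^ 2)) by rw [hc]; ring,
            Real.exp_add]; ring
      _ ≤ _ := by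
          have := mul_le_mul_of_nonneg_right hmax hs
          gcongr

/-- the basic summable bump -/
noncomputable def bump (v : ℝ) : ℝ := v / (1 + v) ^ 2

theorem bump_inv {v : ℝ} (hv : 0 < v) : bump v⁻¹ = bump v := by
  unfold bump; field_simp; ring

theorem bump_nonneg {v : ℝ} (hv : 0 ≤ v) : 0 ≤ bump v := by unfold bump; positivity

theorem bump_sum {v : ℕ → ℝ} {Q : ℝ} (hQ : 1 < Q) (hv : ∀ k, 0 < v k)
    (h : ∀ k, Q * v k ≤ v (k + 1)) (n : ℕ) :
    ∑ k ∈ Finset.range n, bump (v k) ≤ Q / (Q - 1) := by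
  have hQ1 : 0 < Q - 1 := by linarith
  have key : ∑ k ∈ Finset.range n, bump (v k) ≤ Q / (Q - 1) * (v n / (1 + v n)) := by
    induction n with
    | zero => have := hv 0; simp; positivity
    | succ n ih =>
      rw [Finset.sum_range_succ]
      have a := hv n
      have b := hv (n + 1)
      have c := h n
      have h1 : bump (v n) ≤ Q / (Q - 1) * (v (n + 1) / (1 + v (n + 1)) - v n / (1 + v n)) := by
        unfold bump
        rw [div_sub_div _ _ (by positivity) (by positivity), div_mul_div_comm,
          div_le_div_iff₀ (by positivity) (by positivity)]
        have e : v (n + 1) * (1 + v n) - (1 + v (n + 1)) * v n = v (n + 1) - v n := by ring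
        rw [e]
        have e2 : v n * ((Q - 1) * ((1 + v (n + 1)) * (1 + v n))) ≤
            Q * (v (n + 1) - v n) * (1 + v n) * (1 + v n) := by
          have e3 : v n * ((Q - 1) * (1 + v (n + 1))) ≤ Q * (v (n + 1) - v n) * (1 + v n) := by
            nlinarith [mul_nonneg (sub_nonneg.2 c) (show 0 ≤ Q + v n by linarith), mul_nonneg (sq_nonneg (Q - 1)) a.le]
          nlinarith [mul_le_mul_of_nonneg_right e3 (show 0 ≤ 1 + v n by positivity)]
        nlinarith
      linarith
  refine key.trans ?_
  have := hv n
  apply mul_le_of_le_one_right (by positivity)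
  rw [div_le_one (by positivity)]; linarith

theorem bump_sum_down {v : ℕ → ℝ} {Q : ℝ} (hQ : 1 < Q) (hv : ∀ k, 0 < v k)
    (h : ∀ k, Q * v (k + 1) ≤ v k) (n : ℕ) :
    ∑ k ∈ Finset.range n, bump (v k) ≤ Q / (Q - 1) := by
  have := bump_sum (v := fun k => (v k)⁻¹) hQ (fun k => inv_pos.2 (hv k)) (fun k => by
    have a := hv k
    have b := hv (k + 1)
    rw [← div_eq_mul_inv, div_le_iff₀ a, inv_mul_eq_div, le_div_iff₀ b]
    exact h k) n
  refine le_trans (le_of_eq ?_) this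
  exact Finset.sum_congr rfl (fun k _ => (bump_inv (hv k)).symm)

theorem rpow_le_exp {a ε : ℝ} (ha : 0 < a) (hε : 0 < ε) {x : ℝ} (hx : 0 ≤ x) :
    x ^ a ≤ (a / ε) ^ a * Real.exp (ε * x) := by
  have h1 : x ≤ (a / ε) * Real.exp (ε * x / a) := by
    have := Real.add_one_le_exp (ε * x / a)
    calc x = (a / ε) * (ε * x / a) := by field_simp
      _ ≤ _ := by gcongr; linarith
  calc x ^ a ≤ ((a / ε) * Real.exp (ε * x / a)) ^ a := by gcongr
    _ = _ := by
      rw [Real.mul_rpow (by positivity) (Real.exp_pos _).le, ← Real.exp_mul]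
      congr 2; field_simp

theorem kernel_bump {a c : ℝ} (ha : 0 < a) (hc : 0 < c) : ∃ C0, 0 < C0 ∧ ∀ u, 0 < u →
    u ^ a * Real.exp (-(c * u)) ≤ C0 * bump (u ^ a) := by
  refine ⟨2 + 2 * (2 * a / c) ^ (2 * a), by positivity, ?_⟩
  intro u hu
  have h1 := rpow_le_exp (show 0 < 2 * a by positivity) hc hu.le
  have h2 : u ^ (2 * a) = (u ^ a) ^ 2 := by
    rw [mul_comm, Real.rpow_mul hu.le]; norm_cast
  rw [h2] at h1
  have hp : 0 < u ^ a := by positivity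
  have he : 1 ≤ Real.exp (c * u) := Real.one_le_exp (by positivity)
  unfold bump
  rw [Real.exp_neg, ← div_eq_mul_inv, mul_div_assoc', div_le_div_iff₀ (Real.exp_pos _) (by positivity)]
  have h3 : (1 + u ^ a) ^ 2 ≤ 2 + 2 * (u ^ a) ^ 2 := by nlinarith [sq_nonneg (1 - u ^ a)]
  have h4 : (1 + u ^ a) ^ 2 ≤ (2 + 2 * (2 * a / c) ^ (2 * a)) * Real.exp (c * u) := by nlinarith
  calc _ ≤ u ^ a * ((2 + 2 * (2 * a / c) ^ (2 * a)) * Real.exp (c * u)) := by gcongr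
    _ = _ := by ring

theorem lac_pow {v : ℕ → ℝ} {Q a : ℝ} (hQ : 1 < Q) (ha : 0 < a) (hv : ∀ k, 0 < v k)
    (h : ∀ k, Q * v k ≤ v (k + 1)) (k : ℕ) : Q ^ a * v k ^ a ≤ v (k + 1) ^ a := by
  rw [← Real.mul_rpow (by linarith) (hv k).le]
  have := hv k
  exact Real.rpow_le_rpow (by positivity) (h k) ha.le

theorem lac_pos {v : ℕ → ℝ} {Q : ℝ} (hQ : 1 < Q) (h0 : 0 < v 0)
    (h : ∀ k, Q * v k ≤ v (k + 1)) : ∀ k, 0 < v k := by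
  intro k
  induction k with
  | zero => exact h0
  | succ k ih => exact lt_of_lt_of_le (by positivity) (h k)

theorem lac_ge {v : ℕ → ℝ} {Q : ℝ} (hQ : 1 < Q) (h0 : 0 < v 0)
    (h : ∀ k, Q * v k ≤ v (k + 1)) : ∀ k, v 0 ≤ v k := by
  intro k
  induction k with
  | zero => exact le_rfl
  | succ k ih => nlinarith [h k, lac_pos hQ h0 h k]

/-- kernel sums along an increasing lacunary sequence -/
theorem kernel_sum_up {a c Q : ℝ} (ha : 0 < a) (hc : 0 < c) (hQ : 1 < Q) : ∃ S, 0 < S ∧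
    ∀ v : ℕ → ℝ, 0 < v 0 → (∀ k, Q * v k ≤ v (k + 1)) → ∀ x, 0 < x → ∀ n,
      ∑ k ∈ Finset.range n, (v k * x) ^ a * Real.exp (-(c * (v k * x))) ≤ S := by
  obtain ⟨C0, hC0, hk⟩ := kernel_bump ha hc
  have hQa : 1 < Q ^ a := Real.one_lt_rpow hQ ha
  have : 0 < Q ^ a - 1 := by linarith
  refine ⟨C0 * (Q ^ a / (Q ^ a - 1)), by positivity, ?_⟩
  intro v h0 h x hx n
  have hv := lac_pos hQ h0 h
  have hvx : ∀ k, 0 < v k * x := fun k => mul_pos (hv k) hx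
  refine (Finset.sum_le_sum (fun k _ => hk (v k * x) (hvx k))).trans ?_
  rw [← Finset.mul_sum]
  gcongr
  refine bump_sum hQa (v := fun k => (v k * x) ^ a) (fun k => Real.rpow_pos_of_pos (hvx k) _) ?_ n
  exact lac_pow hQ ha (v := fun k => v k * x) hvx (fun k => by nlinarith [h k])

/-- kernel sums along a decreasing lacunary sequence -/
theorem kernel_sum_down {a c Q : ℝ} (ha : 0 < a) (hc : 0 < c) (hQ : 1 < Q) : ∃ S, 0 < S ∧
    ∀ v : ℕ → ℝ, 0 < v 0 → (∀ k, Q * v k ≤ v (k + 1)) → ∀ x, 0 < x → ∀ n,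
      ∑ k ∈ Finset.range n, (x / v k) ^ a * Real.exp (-(c * (x / v k))) ≤ S := by
  obtain ⟨C0, hC0, hk⟩ := kernel_bump ha hc
  have hQa : 1 < Q ^ a := Real.one_lt_rpow hQ ha
  have : 0 < Q ^ a - 1 := by linarith
  refine ⟨C0 * (Q ^ a / (Q ^ a - 1)), by positivity, ?_⟩
  intro v h0 h x hx n
  have hv := lac_pos hQ h0 h
  have hvx : ∀ k, 0 < v k * x⁻¹ := fun k => mul_pos (hv k) (inv_pos.2 hx)
  refine (Finset.sum_le_sum (fun k _ => hk (x / v k) (div_pos hx (hv k)))).trans ?_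
  rw [← Finset.mul_sum]
  gcongr
  have e : ∀ k, bump ((x / v k) ^ a) = bump ((v k * x⁻¹) ^ a) := by
    intro k
    rw [← bump_inv (Real.rpow_pos_of_pos (hvx k) _), ← Real.inv_rpow (hvx k).le]
    congr 2
    rw [mul_inv, inv_inv]; ring
  simp_rw [e]
  refine bump_sum hQa (v := fun k => (v k * x⁻¹) ^ a) (fun k => Real.rpow_pos_of_pos (hvx k) _) ?_ n
  exact lac_pow hQ ha (v := fun k => v k * x⁻¹) hvx (fun k => by
    have := inv_pos.2 hx; nlinarith [h k])

theorem sum_neg_pow_le {b Q : ℝ} (hb : 0 < b) (hQ : 1 < Q) {v : ℕ → ℝ} (h0 : 0 < v 0)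
    (h : ∀ k, Q * v k ≤ v (k + 1)) {x : ℝ} (hx : 0 < x) (n : ℕ) :
    ∑ k ∈ Finset.range n, (if 1 ≤ v k * x then (v k * x) ^ (-b) else 0) ≤ 4 * (Q ^ b / (Q ^ b - 1)) := by
  have hQa : 1 < Q ^ b := Real.one_lt_rpow hQ hb
  have hv := lac_pos hQ h0 h
  have hvx : ∀ k, 0 < v k * x := fun k => mul_pos (hv k) hx
  have key : ∀ k ∈ Finset.range n, (if 1 ≤ v k * x then (v k * x) ^ (-b) else 0) ≤
      4 * bump ((v k * x) ^ b) := by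
    intro k _
    split_ifs with hk
    · rw [Real.rpow_neg (hvx k).le]
      have h1 : 1 ≤ (v k * x) ^ b := Real.one_le_rpow hk hb.le
      generalize (v k * x) ^ b = w at h1
      unfold bump
      rw [inv_eq_one_div, mul_div_assoc', div_le_div_iff₀ (by positivity) (by positivity)]
      nlinarith
    · have := bump_nonneg (Real.rpow_pos_of_pos (hvx k) b).le
      linarith
  refine (Finset.sum_le_sum key).trans ?_
  rw [← Finset.mul_sum]
  gcongr
  refine bump_sum hQa (v := fun k => (v k * x) ^ b) (fun k => Real.rpow_pos_of_pos (hvx k) _) ?_ n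
  exact lac_pow hQ hb (v := fun k => v k * x) hvx (fun k => by nlinarith [h k])

theorem rpow_compare {m y b : ℝ} (hm : 0 < m) (h1 : m / 2 ≤ y) (h2 : y ≤ m) :
    m ^ b ≤ 2 ^ |b| * y ^ b := by
  have hy : 0 < y := lt_of_lt_of_le (by positivity) h1
  rcases le_total 0 b with hb | hb
  · rw [abs_of_nonneg hb, ← Real.mul_rpow (by norm_num) hy.le]
    exact Real.rpow_le_rpow hm.le (by linarith) hb
  · have h3 : m ^ b ≤ y ^ b := Real.rpow_le_rpow_of_nonpos hy h2 hb
    have h4 : (1:ℝ) ≤ 2 ^ |b| := Real.one_le_rpow (by norm_num) (abs_nonneg _)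
    have : 0 ≤ y ^ b := by positivity
    nlinarith

theorem one_sub_exp_bounds {x : ℝ} (hx : 0 < x) :
    min x 1 / 2 ≤ 1 - Real.exp (-x) ∧ 1 - Real.exp (-x) ≤ min x 1 := by
  constructor
  · have key : ∀ y : ℝ, 0 ≤ y → y ≤ 1 → y / 2 ≤ 1 - Real.exp (-y) := by
      intro y h0 h1
      have := Real.add_one_le_exp y
      have h2 : Real.exp (-y) ≤ 1 / (1 + y) := by
        rw [Real.exp_neg, ← one_div]
        exact one_div_le_one_div_of_le (by linarith) (by linarith)
      have h3 : 1 / (1 + y) ≤ 1 - y / 2 := by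
        rw [div_le_iff₀ (by linarith)]; nlinarith
      linarith
    have h1 := key (min x 1) (by positivity) (min_le_right _ _)
    have h2 : Real.exp (-x) ≤ Real.exp (-(min x 1)) := Real.exp_le_exp.2 (neg_le_neg (min_le_left _ _))
    linarith
  · apply le_min
    · have := Real.add_one_le_exp (-x); linarith
    · have := Real.exp_pos (-x); linarith

theorem weight_sum (α : ℝ) (hα : 0 < α) {Q : ℝ} (hQ : 1 < Q) {v : ℕ → ℝ} (h0 : 0 < v 0)
    (h : ∀ k, Q * v k ≤ v (k + 1)) : ∃ C, 0 < C ∧ ∀ x, 0 < x → ∀ n,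
    ∑ k ∈ Finset.range n, (if 1 / v k < x then v k ^ (-α) * (v k * ((v k * x) ^ 2)⁻¹) else 0)
      ≤ C * (1 - Real.exp (-x)) ^ (α - 1) := by
  have hv := lac_pos hQ h0 h
  set b := 1 + α with hb
  have hb0 : 0 < b := by positivity
  have hQa : 1 < Q ^ b := Real.one_lt_rpow hQ hb0
  have hQa' : 0 < Q ^ b - 1 := by linarith
  set S := 4 * (Q ^ b / (Q ^ b - 1)) with hS
  have hS0 : 0 < S := by positivity
  have hterm : ∀ k x, 0 < x → v k ^ (-α) * (v k * ((v k * x) ^ 2)⁻¹) = x ^ (α - 1) * (v k * x) ^ (-b) := by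
    intro k x hx
    have := hv k
    have e1 : ((v k * x) ^ 2)⁻¹ = v k ^ (-2 : ℝ) * x ^ (-2 : ℝ) := by
      rw [← Real.mul_rpow this.le hx.le, Real.rpow_neg (by positivity)]; norm_num
    rw [e1, Real.mul_rpow this.le hx.le]
    nth_rewrite 2 [← Real.rpow_one (v k)]
    calc _ = (v k ^ (-α) * v k ^ (1:ℝ) * v k ^ (-2:ℝ)) * x ^ (-2 : ℝ) := by ring
      _ = v k ^ (-b) * x ^ (-2 : ℝ) := by
        rw [← Real.rpow_add this, ← Real.rpow_add this]; congr 2; rw [hb]; ring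
      _ = v k ^ (-b) * (x ^ (α - 1) * x ^ (-b)) := by
        rw [← Real.rpow_add hx]; congr 2; rw [hb]; ring
      _ = _ := by ring
  have hW : ∀ x, 0 < x → (min x 1) ^ (α - 1) ≤ 2 ^ |α - 1| * (1 - Real.exp (-x)) ^ (α - 1) := by
    intro x hx
    obtain ⟨h1, h2⟩ := one_sub_exp_bounds hx
    exact rpow_compare (by positivity) h1 h2
  set B := v 0 ^ (-b) with hB
  have hB0 : 0 < B := Real.rpow_pos_of_pos h0 _
  refine ⟨S * (1 + B) * 2 ^ |α - 1|, by positivity, ?_⟩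
  intro x hx n
  have hmain : ∑ k ∈ Finset.range n, (if 1 / v k < x then v k ^ (-α) * (v k * ((v k * x) ^ 2)⁻¹) else 0)
      ≤ S * (1 + B) * (min x 1) ^ (α - 1) := by
    rcases le_total x 1 with hx1 | hx1
    · rw [min_eq_left hx1]
      calc _ ≤ ∑ k ∈ Finset.range n, x ^ (α - 1) * (if 1 ≤ v k * x then (v k * x) ^ (-b) else 0) := by
            apply Finset.sum_le_sum
            intro k _
            have hk := hv k
            split_ifs with h1 h2 h2
            · rw [hterm k x hx]
            · exfalso; apply h2
              rw [div_lt_iff₀ hk] at h1; linarith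
            · positivity
            · simp
        _ ≤ x ^ (α - 1) * S := by
            rw [← Finset.mul_sum]
            gcongr
            exact sum_neg_pow_le hb0 hQ h0 h hx n
        _ ≤ _ := by
            have : 0 < x ^ (α - 1) := by positivity
            nlinarith [mul_pos (mul_pos hS0 hB0) this]
    · rw [min_eq_right hx1, Real.one_rpow, mul_one]
      calc _ ≤ ∑ k ∈ Finset.range n, B * (if 1 ≤ v k * (v 0)⁻¹ then (v k * (v 0)⁻¹) ^ (-b) else 0) := by
            apply Finset.sum_le_sum
            intro k _
            have hk := hv k
            have hk0 := lac_ge hQ h0 h k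
            have e0 : 1 ≤ v k * (v 0)⁻¹ := by rw [← div_eq_mul_inv, le_div_iff₀ h0]; linarith
            rw [if_pos e0]
            have e1 : B * (v k * (v 0)⁻¹) ^ (-b) = v k ^ (-b) := by
              rw [hB, ← Real.mul_rpow h0.le (by positivity)]; congr 1; field_simp
            rw [e1]
            split_ifs with h1
            · have e2 := hterm k 1 one_pos
              rw [mul_one, Real.one_rpow, one_mul] at e2
              rw [← e2]
              gcongr
              nlinarith
            · positivity
        _ ≤ B * S := by
            rw [← Finset.mul_sum]
            gcongr
            exact sum_neg_pow_le hb0 hQ h0 h (inv_pos.2 h0) n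
        _ ≤ _ := by nlinarith
  refine hmain.trans ?_
  rw [mul_assoc (S * (1 + B))]
  exact mul_le_mul_of_nonneg_left (hW x hx) (by positivity)

theorem nu_cov (α : ℝ) {g : ℝ → ENNReal} (hg : Measurable g) :
    ∫⁻ t, g t ∂(nuMeas α) = ∫⁻ s in Ioi (0:ℝ),
      ENNReal.ofReal ((1 - Real.exp (-s)) ^ (α - 1) * Real.exp (-s)) * g (Real.exp (-s)) := by
  unfold nuMeas
  have hm : Measurable fun x : ℝ => ENNReal.ofReal ((1 - x) ^ (α - 1)) := by fun_prop
  rw [lintegral_withDensity_eq_lintegral_mul _ hm hg]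
  rw [← restrict_Ioo_eq_restrict_Icc]
  have himg : (fun s : ℝ => Real.exp (-s)) '' Ioi 0 = Ioo 0 1 := by
    ext y
    simp only [mem_image, mem_Ioi, mem_Ioo]
    constructor
    · rintro ⟨x, hx, rfl⟩
      exact ⟨Real.exp_pos _, by rw [Real.exp_lt_one_iff]; linarith⟩
    · rintro ⟨h0, h1⟩
      exact ⟨-Real.log y, by have := Real.log_neg h0 h1; linarith, by rw [neg_neg, Real.exp_log h0]⟩
  rw [← himg, lintegral_image_eq_lintegral_abs_deriv_mul measurableSet_Ioi
    (f' := fun s => -Real.exp (-s))]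
  · apply lintegral_congr
    intro s
    simp only [Pi.mul_apply, abs_neg, Real.abs_exp]
    rw [← mul_assoc, ← ENNReal.ofReal_mul (Real.exp_pos _).le, mul_comm (Real.exp (-s))]
  · intro x _
    have := ((hasDerivAt_id x).neg.exp).hasDerivWithinAt (s := Ioi 0)
    simpa using this
  · intro x _ y _ hxy
    have := Real.exp_injective hxy
    linarith

theorem DK_jensen {ℓ r : ℝ} (hℓ : 0 < ℓ) (hr : 1 ≤ r) {F : ℝ → ℂ} (hF : Continuous F) :
    ENNReal.ofReal (DK ℓ F) ^ r ≤
      ∫⁻ x in Ioi (1 / ℓ), ENNReal.ofReal (ℓ * ((ℓ * x) ^ 2)⁻¹) * ‖F x‖ₑ ^ r := by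
  have hm : Measurable fun x : ℝ => ENNReal.ofReal (ℓ * ((ℓ * x) ^ 2)⁻¹) := by fun_prop
  set P := (volume.restrict (Ioi (1 / ℓ))).withDensity
    (fun x => ENNReal.ofReal (ℓ * ((ℓ * x) ^ 2)⁻¹)) with hP
  have hprob : IsProbabilityMeasure P := by
    constructor
    rw [hP, withDensity_apply _ MeasurableSet.univ, Measure.restrict_univ]
    have hi : IntegrableOn (fun x : ℝ => ℓ⁻¹ * x ^ (-2 : ℝ)) (Ioi (1 / ℓ)) :=
      (integrableOn_Ioi_rpow_of_lt (by norm_num) (by positivity)).const_mul _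
    have hE : EqOn (fun x : ℝ => ℓ * ((ℓ * x) ^ 2)⁻¹) (fun x : ℝ => ℓ⁻¹ * x ^ (-2 : ℝ)) (Ioi (1 / ℓ)) := by
      intro x hx
      have hx0 : 0 < x := lt_trans (by positivity) hx
      simp only
      rw [Real.rpow_neg hx0.le]
      norm_cast
      field_simp
    rw [setLIntegral_congr_fun measurableSet_Ioi (fun x hx => congrArg ENNReal.ofReal (hE hx)),
      ← ofReal_integral_eq_lintegral_ofReal hi]
    · rw [integral_const_mul, integral_Ioi_rpow_of_lt (by norm_num) (by positivity)]
      norm_num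
      rw [Real.rpow_neg_one]; field_simp
    · rw [EventuallyLE, ae_restrict_iff' measurableSet_Ioi]
      filter_upwards with x hx
      have hx0 : 0 < x := lt_trans (by positivity) hx
      simp only [Pi.zero_apply]; positivity
  have key := eLpNorm'_le_eLpNorm'_of_exponent_le one_pos hr P (f := F) hF.aestronglyMeasurable
  have hr0 : 0 < r := by linarith
  unfold eLpNorm' at key
  have e1 : ENNReal.ofReal (DK ℓ F) ≤ ∫⁻ x, ‖F x‖ₑ ∂P := by
    rw [hP, lintegral_withDensity_eq_lintegral_mul _ hm hF.measurable.enorm]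
    have hd : DK ℓ F = ∫ x in Ioi (1 / ℓ), ℓ * (‖F x‖ * ((ℓ * x) ^ 2)⁻¹) := by
      rw [integral_const_mul]; rfl
    rw [hd]
    refine (Real.ofReal_le_enorm _).trans ((enorm_integral_le_lintegral_enorm _).trans (le_of_eq ?_))
    apply lintegral_congr
    intro x
    simp only [Pi.mul_apply]
    rw [← ofReal_norm, ← ofReal_norm, ← ENNReal.ofReal_mul (by positivity)]
    congr 1
    rw [Real.norm_of_nonneg (by positivity)]; ring
  have e2 : ∫⁻ x, ‖F x‖ₑ ^ r ∂P = ∫⁻ x in Ioi (1 / ℓ), ENNReal.ofReal (ℓ * ((ℓ * x) ^ 2)⁻¹) * ‖F x‖ₑ ^ r := by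
    rw [hP, lintegral_withDensity_eq_lintegral_mul _ hm (hF.measurable.enorm.pow_const r)]; rfl
  rw [← e2]
  simp only [ENNReal.rpow_one, div_one] at key
  calc _ ≤ ((∫⁻ x, ‖F x‖ₑ ^ r ∂P) ^ (1 / r)) ^ r := by
        gcongr; exact e1.trans key
    _ = _ := by rw [← ENNReal.rpow_mul, one_div, inv_mul_cancel₀ hr0.ne', ENNReal.rpow_one]

/-- the Müntz polynomial as a function on `[0,1]` -/
noncomputable def mP (Λ : ℕ → ℝ) (K : ℕ) (a : ℕ → ℂ) (t : ℝ) : ℂ :=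
  ∑ j ∈ Finset.range K, a j * ((t ^ (Λ j) : ℝ) : ℂ)

theorem mP_exp (Λ : ℕ → ℝ) (K : ℕ) (a : ℕ → ℂ) (s : ℝ) :
    mP Λ K a (Real.exp (-s)) = eP Λ K a s := by
  unfold mP eP
  apply Finset.sum_congr rfl
  intro j _
  rw [← Real.exp_mul]; congr 3; ring

theorem mP_measurable (Λ : ℕ → ℝ) (K : ℕ) (a : ℕ → ℂ) : Measurable (mP Λ K a) := by
  unfold mP
  apply Finset.measurable_sum
  intro j _
  fun_prop

theorem eP_expshift (Λ : ℕ → ℝ) (σ : ℝ) (K : ℕ) (a : ℕ → ℂ) (s : ℝ) :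
    eP (fun j => Λ j + σ) K a s = ((Real.exp (-(σ * s)) : ℝ) : ℂ) * eP Λ K a s := by
  unfold eP
  rw [Finset.mul_sum]
  apply Finset.sum_congr rfl
  intro j _
  have : Real.exp (-((Λ j + σ) * s)) = Real.exp (-(σ * s)) * Real.exp (-(Λ j * s)) := by
    rw [← Real.exp_add]; congr 1; ring
  rw [this]; push_cast; ring

theorem lower_bound {α r : ℝ} (hα : 0 < α) (hr : 1 ≤ r) {Q : ℝ} (hQ : 1 < Q) {ℓ : ℕ → ℝ}
    (h0 : 0 < ℓ 0) (h : ∀ k, Q * ℓ k ≤ ℓ (k + 1)) : ∃ C, 0 < C ∧ ∀ (Λ : ℕ → ℝ) (K : ℕ) (a : ℕ → ℂ) (m : ℕ),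
    ∑ k ∈ Finset.range m, ENNReal.ofReal (ℓ k ^ (-α)) *
      ENNReal.ofReal (DK (ℓ k) (eP (fun j => Λ j + 1 / r) K a)) ^ r ≤
      ENNReal.ofReal C * ∫⁻ t, ‖mP Λ K a t‖ₑ ^ r ∂(nuMeas α) := by
  obtain ⟨C, hC, hw⟩ := weight_sum α hα hQ h0 h
  have hℓ := lac_pos hQ h0 h
  have hr0 : 0 < r := by linarith
  refine ⟨C, hC, fun Λ K a m => ?_⟩
  rw [nu_cov α ((mP_measurable Λ K a).enorm.pow_const r)]
  set F := eP (fun j => Λ j + 1 / r) K a with hF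
  have hFc : Continuous F := eP_continuous _ _ _
  have hFm : Measurable fun x => ‖F x‖ₑ ^ r := hFc.measurable.enorm.pow_const r
  have hwm : ∀ k, Measurable fun x : ℝ => ENNReal.ofReal (ℓ k ^ (-α) * (ℓ k * ((ℓ k * x) ^ 2)⁻¹)) := by
    intro k; fun_prop
  have s1 : ∀ k, ENNReal.ofReal (ℓ k ^ (-α)) * ENNReal.ofReal (DK (ℓ k) F) ^ r ≤
      ∫⁻ x in Ioi (0:ℝ), ENNReal.ofReal (if 1 / ℓ k < x then ℓ k ^ (-α) * (ℓ k * ((ℓ k * x) ^ 2)⁻¹) else 0) * ‖F x‖ₑ ^ r := by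
    intro k
    have hk := hℓ k
    calc _ ≤ ENNReal.ofReal (ℓ k ^ (-α)) * ∫⁻ x in Ioi (1 / ℓ k), ENNReal.ofReal (ℓ k * ((ℓ k * x) ^ 2)⁻¹) * ‖F x‖ₑ ^ r := by
          gcongr; exact DK_jensen hk hr hFc
      _ = ∫⁻ x in Ioi (1 / ℓ k), ENNReal.ofReal (ℓ k ^ (-α) * (ℓ k * ((ℓ k * x) ^ 2)⁻¹)) * ‖F x‖ₑ ^ r := by
          rw [← lintegral_const_mul' _ _ ENNReal.ofReal_ne_top]
          apply lintegral_congr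
          intro x
          rw [ENNReal.ofReal_mul (p := ℓ k ^ (-α)) (by positivity), mul_assoc]
      _ = ∫⁻ x in Ioi (1 / ℓ k), ENNReal.ofReal (if 1 / ℓ k < x then ℓ k ^ (-α) * (ℓ k * ((ℓ k * x) ^ 2)⁻¹) else 0) * ‖F x‖ₑ ^ r := by
          apply setLIntegral_congr_fun measurableSet_Ioi
          intro x hx
          simp only
          rw [if_pos (show 1 / ℓ k < x from hx)]
      _ ≤ _ := by
          apply lintegral_mono_set
          apply Ioi_subset_Ioi; positivity
  refine (Finset.sum_le_sum fun k _ => s1 k).trans ?_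
  rw [← lintegral_finsetSum, ← lintegral_const_mul' _ _ ENNReal.ofReal_ne_top]
  · apply setLIntegral_mono'  measurableSet_Ioi
    intro x hx
    rw [← Finset.sum_mul, ← ENNReal.ofReal_sum_of_nonneg]
    · have e1 : ‖F x‖ₑ ^ r = ENNReal.ofReal (Real.exp (-x)) * ‖mP Λ K a (Real.exp (-x))‖ₑ ^ r := by
        rw [mP_exp, hF, eP_expshift, enorm_mul, ENNReal.mul_rpow_of_nonneg _ _ hr0.le]
        congr 1
        rw [← ofReal_norm, Complex.norm_real, Real.norm_of_nonneg (Real.exp_pos _).le,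
          ENNReal.ofReal_rpow_of_pos (Real.exp_pos _), ← Real.exp_mul]
        congr 2; field_simp
      rw [e1, ← mul_assoc, ← mul_assoc, ← ENNReal.ofReal_mul hC.le, ← mul_assoc C]
      gcongr
      rw [← ENNReal.ofReal_mul' (Real.exp_pos _).le]
      gcongr
      exact hw x hx m
    · intro k _
      have := hℓ k
      split_ifs <;> positivity
  · intro k _
    apply Measurable.mul _ hFm
    apply Measurable.ennreal_ofReal
    apply Measurable.ite (measurableSet_lt measurable_const measurable_id) (by fun_prop) measurable_const

theorem schur_finite {r S : ℝ} (hr : 1 ≤ r) (hS : 0 ≤ S) (m l : ℕ) (x : ℕ → ℝ) (ψ : ℕ → ℕ → ℝ)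
    (hx : ∀ k, 0 ≤ x k) (hψ : ∀ k j, 0 ≤ ψ k j)
    (hrow : ∀ j, ∑ k ∈ Finset.range m, ψ k j ≤ S) (hcol : ∀ k, ∑ j ∈ Finset.range l, ψ k j ≤ S) :
    ∑ j ∈ Finset.range l, (∑ k ∈ Finset.range m, x k * ψ k j) ^ r ≤
      S ^ r * ∑ k ∈ Finset.range m, x k ^ r := by
  have hr0 : 0 < r := by linarith
  have h1 : ∀ j, (∑ k ∈ Finset.range m, x k * ψ k j) ^ r ≤
      S ^ (r - 1) * ∑ k ∈ Finset.range m, ψ k j * x k ^ r := by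
    intro j
    have := Real.inner_le_weight_mul_Lp_of_nonneg (Finset.range m) hr (fun k => ψ k j) x
      (fun k => hψ k j) hx
    have hs0 : 0 ≤ ∑ k ∈ Finset.range m, ψ k j := Finset.sum_nonneg fun k _ => hψ k j
    have hs1 : 0 ≤ ∑ k ∈ Finset.range m, ψ k j * x k ^ r :=
      Finset.sum_nonneg fun k _ => mul_nonneg (hψ k j) (Real.rpow_nonneg (hx k) _)
    have hs2 : 0 ≤ ∑ k ∈ Finset.range m, ψ k j * x k :=
      Finset.sum_nonneg fun k _ => mul_nonneg (hψ k j) (hx k)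
    calc _ = (∑ k ∈ Finset.range m, ψ k j * x k) ^ r := by simp_rw [mul_comm (x _)]
      _ ≤ ((∑ k ∈ Finset.range m, ψ k j) ^ (1 - r⁻¹) * (∑ k ∈ Finset.range m, ψ k j * x k ^ r) ^ r⁻¹) ^ r :=
          Real.rpow_le_rpow hs2 this hr0.le
      _ = (∑ k ∈ Finset.range m, ψ k j) ^ (r - 1) * (∑ k ∈ Finset.range m, ψ k j * x k ^ r) := by
          rw [Real.mul_rpow (by positivity) (by positivity), ← Real.rpow_mul hs0, ← Real.rpow_mul hs1,
            inv_mul_cancel₀ hr0.ne', Real.rpow_one]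
          congr 2; field_simp
      _ ≤ _ := by
          exact mul_le_mul_of_nonneg_right (Real.rpow_le_rpow hs0 (hrow j) (by linarith)) hs1
  calc _ ≤ ∑ j ∈ Finset.range l, S ^ (r - 1) * ∑ k ∈ Finset.range m, ψ k j * x k ^ r :=
        Finset.sum_le_sum fun j _ => h1 j
    _ = S ^ (r - 1) * ∑ k ∈ Finset.range m, (∑ j ∈ Finset.range l, ψ k j) * x k ^ r := by
        rw [← Finset.mul_sum, Finset.sum_comm]
        simp_rw [Finset.sum_mul]
    _ ≤ S ^ (r - 1) * ∑ k ∈ Finset.range m, S * x k ^ r := by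
        have : ∀ k, 0 ≤ x k ^ r := fun k => Real.rpow_nonneg (hx k) _
        have h2 : ∑ k ∈ Finset.range m, (∑ j ∈ Finset.range l, ψ k j) * x k ^ r ≤ ∑ k ∈ Finset.range m, S * x k ^ r :=
          Finset.sum_le_sum fun k _ => mul_le_mul_of_nonneg_right (hcol k) (this k)
        exact mul_le_mul_of_nonneg_left h2 (Real.rpow_nonneg hS _)
    _ = S ^ (r - 1) * S * ∑ k ∈ Finset.range m, x k ^ r := by rw [← Finset.mul_sum, mul_assoc]
    _ = _ := by
        congr 1
        rcases hS.eq_or_lt with h | h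
        · rw [← h, mul_zero, Real.zero_rpow hr0.ne']
        · nth_rewrite 2 [← Real.rpow_one S]
          rw [← Real.rpow_add h]; congr 1; ring

theorem xi_lac {Λ : ℕ → ℝ} {n : ℕ → ℕ} {N : ℕ} (h : IsQuasiLacunary Λ n N) :
    ∃ q, 1 < q ∧ ∀ k, q * Λ (n k) ≤ Λ (n (k + 1)) := by
  obtain ⟨q, hq, he⟩ := h.ratio
  obtain ⟨J, hJ⟩ := eventually_atTop.1 he
  obtain ⟨q2, hq2, h2⟩ := initial_ratio (fun k => Λ (n k)) (fun k => h.pos _)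
    (h.mono.comp h.n_mono) J
  refine ⟨min q q2, lt_min hq hq2, fun k => ?_⟩
  have := h.pos (n k)
  rcases lt_or_ge k J with hk | hk
  · exact (mul_le_mul_of_nonneg_right (min_le_right _ _) this.le).trans (h2 k hk)
  · exact (mul_le_mul_of_nonneg_right (min_le_left _ _) this.le).trans (hJ k hk).le

theorem xi_ub {Λ : ℕ → ℝ} {n : ℕ → ℕ} {N : ℕ} (h : IsQuasiLacunary Λ n N) (hs : IsSubgeometric Λ n) :
    ∃ q, 1 < q ∧ ∀ k, Λ (n (k + 1)) ≤ q * Λ (n k) := by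
  obtain ⟨q, hq, he⟩ := hs
  obtain ⟨J, hJ⟩ := eventually_atTop.1 he
  obtain ⟨q2, hq2, h2⟩ := initial_ratio_ub (fun k => Λ (n k)) (fun k => h.pos _) J
  refine ⟨max q q2, lt_of_lt_of_le hq (le_max_left _ _), fun k => ?_⟩
  have := h.pos (n k)
  rcases lt_or_ge k J with hk | hk
  · exact (h2 k hk).trans (mul_le_mul_of_nonneg_right (le_max_right _ _) this.le)
  · exact (hJ k hk).trans (mul_le_mul_of_nonneg_right (le_max_left _ _) this.le)

theorem nu_weight_le {α s : ℝ} (hα : 0 < α) (hs : 0 < s) :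
    (1 - Real.exp (-s)) ^ (α - 1) * Real.exp (-s) ≤ s ^ (α - 1) := by
  have h1 : Real.exp (-s) < 1 := by rw [Real.exp_lt_one_iff]; linarith
  have h2 := Real.exp_pos (-s)
  rcases le_total 1 α with ha | ha
  · have h3 : 1 - Real.exp (-s) ≤ s := by linarith [Real.add_one_le_exp (-s)]
    have h4 : (1 - Real.exp (-s)) ^ (α - 1) ≤ s ^ (α - 1) :=
      Real.rpow_le_rpow (by linarith) h3 (by linarith)
    have : 0 ≤ (1 - Real.exp (-s)) ^ (α - 1) := Real.rpow_nonneg (by linarith) _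
    nlinarith
  · have h3 : s * Real.exp (-s) ≤ 1 - Real.exp (-s) := by
      have := Real.add_one_le_exp s
      have e : Real.exp s * Real.exp (-s) = 1 := by rw [← Real.exp_add]; simp
      nlinarith
    have h4 : (1 - Real.exp (-s)) ^ (α - 1) ≤ (s * Real.exp (-s)) ^ (α - 1) :=
      Real.rpow_le_rpow_of_nonpos (by positivity) h3 (by linarith)
    rw [Real.mul_rpow hs.le h2.le, ← Real.exp_mul] at h4
    calc _ ≤ s ^ (α - 1) * Real.exp (-s * (α - 1)) * Real.exp (-s) := by gcongr
      _ = s ^ (α - 1) * Real.exp (-(α * s)) := by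
          rw [mul_assoc, ← Real.exp_add]; congr 2; ring
      _ ≤ s ^ (α - 1) * 1 := by
          gcongr
          rw [Real.exp_le_one_iff]
          have : 0 < α * s := by positivity
          linarith
      _ = _ := mul_one _

theorem tsum_holder {p q : ℝ} (hpq : p.HolderConjugate q) (f g : ℕ → ENNReal) :
    ∑' j, f j * g j ≤ (∑' j, f j ^ p) ^ (1 / p) * (∑' j, g j ^ q) ^ (1 / q) := by
  have := ENNReal.lintegral_mul_le_Lp_mul_Lq (Measure.count : Measure ℕ) hpq
    (f := f) (g := g) (measurable_of_countable f).aemeasurable (measurable_of_countable g).aemeasurable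
  simpa [lintegral_count] using this

theorem pick_index {ξ : ℕ → ℝ} {Q : ℝ} (hpos : ∀ k, 0 < ξ k) (hT : Tendsto ξ atTop atTop)
    (hQ : 1 < Q) (hub : ∀ k, ξ (k + 1) ≤ Q * ξ k) {s : ℝ} (hs : 0 < s) :
    ∃ j, 1 / ξ j ≤ s ∧ (j = 0 ∨ ξ j * s ≤ Q) := by
  have hex : ∃ j, 1 / ξ j ≤ s := by
    obtain ⟨j, hj⟩ := (hT.eventually_ge_atTop (1 / s)).exists
    refine ⟨j, ?_⟩
    rw [div_le_iff₀ (hpos j)]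
    rw [div_le_iff₀ hs] at hj
    linarith
  classical
  refine ⟨Nat.find hex, Nat.find_spec hex, ?_⟩
  rcases hj : Nat.find hex with _ | i
  · left; rfl
  · right
    have h1 : ¬ (1 / ξ i ≤ s) := Nat.find_min hex (by omega)
    push Not at h1
    have hi := hpos i
    rw [lt_div_iff₀ hi] at h1
    have := hub i
    nlinarith

/-- the majorant -/
noncomputable def GG (D ℓ : ℕ → ℝ) (c1 : ℝ) (K : ℕ) (x : ℝ) : ℝ :=
  ∑ k ∈ Finset.range K, D k * Real.exp (-(c1 * (ℓ k / x)))

theorem GG_nonneg {D ℓ : ℕ → ℝ} {c1 : ℝ} {K : ℕ} {x : ℝ} (hD : ∀ k, 0 ≤ D k) : 0 ≤ GG D ℓ c1 K x :=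
  Finset.sum_nonneg fun k _ => mul_nonneg (hD k) (Real.exp_pos _).le

theorem majorant {D ℓ ξ : ℕ → ℝ} {c1 : ℝ} {K : ℕ} {Q : ℝ} (hD : ∀ k, 0 ≤ D k) (hℓ : ∀ k, 0 < ℓ k)
    (hc1 : 0 < c1) (hpos : ∀ k, 0 < ξ k) (hT : Tendsto ξ atTop atTop)
    (hQ : 1 < Q) (hub : ∀ k, ξ (k + 1) ≤ Q * ξ k) {s : ℝ} (hs : 0 < s) :
    ∃ j, ∑ k ∈ Finset.range K, D k * Real.exp (-(max (c1 * ℓ k) (ξ 0) * s)) ≤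
      Real.exp Q * (GG D ℓ c1 K (ξ j) * Real.exp (-(ξ j * s))) := by
  obtain ⟨j, h1, h2⟩ := pick_index hpos hT hQ hub hs
  refine ⟨j, ?_⟩
  unfold GG
  rw [Finset.sum_mul, Finset.mul_sum]
  apply Finset.sum_le_sum
  intro k _
  have e : Real.exp Q * (D k * Real.exp (-(c1 * (ℓ k / ξ j))) * Real.exp (-(ξ j * s))) =
      D k * Real.exp (Q + -(c1 * (ℓ k / ξ j)) + -(ξ j * s)) := by
    rw [Real.exp_add, Real.exp_add]; ring
  rw [e]
  apply mul_le_mul_of_nonneg_left _ (hD k)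
  apply Real.exp_le_exp.2
  have hk := hℓ k
  have hj := hpos j
  rcases h2 with rfl | h2
  · have m1 := le_max_left (c1 * ℓ k) (ξ 0)
    have m2 := le_max_right (c1 * ℓ k) (ξ 0)
    have a1 : c1 * (ℓ k / ξ 0) = c1 * ℓ k * (1 / ξ 0) := by ring
    have a2 : c1 * ℓ k * (1 / ξ 0) ≤ max (c1 * ℓ k) (ξ 0) * (1 / ξ 0) :=
      mul_le_mul_of_nonneg_right m1 (by positivity)
    have a3 : ξ 0 * (s - 1 / ξ 0) ≤ max (c1 * ℓ k) (ξ 0) * (s - 1 / ξ 0) :=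
      mul_le_mul_of_nonneg_right m2 (by linarith)
    have a4 : ξ 0 * (1 / ξ 0) = 1 := by field_simp
    rw [a1]
    nlinarith
  · have m1 := le_max_left (c1 * ℓ k) (ξ 0)
    have a1 : c1 * (ℓ k / ξ j) = c1 * ℓ k * (1 / ξ j) := by ring
    have a2 : c1 * ℓ k * (1 / ξ j) ≤ c1 * ℓ k * s :=
      mul_le_mul_of_nonneg_left h1 (by positivity)
    have a3 : c1 * ℓ k * s ≤ max (c1 * ℓ k) (ξ 0) * s :=
      mul_le_mul_of_nonneg_right m1 hs.le
    rw [a1]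
    linarith

theorem GG_schur {α r c1 : ℝ} (hα : 0 < α) (hr : 1 ≤ r) (hc1 : 0 < c1) {ℓ ξ : ℕ → ℝ} {q1 q2 : ℝ}
    (hq1 : 1 < q1) (hq2 : 1 < q2) (hℓ0 : 0 < ℓ 0) (hξ0 : 0 < ξ 0)
    (hℓ : ∀ k, q1 * ℓ k ≤ ℓ (k + 1)) (hξ : ∀ k, q2 * ξ k ≤ ξ (k + 1)) :
    ∃ C, 0 < C ∧ ∀ (D : ℕ → ℝ), (∀ k, 0 ≤ D k) → ∀ K l : ℕ,
      ∑ j ∈ Finset.range l, ξ j ^ (-α) * GG D ℓ c1 K (ξ j) ^ r ≤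
        C * ∑ k ∈ Finset.range K, ℓ k ^ (-α) * D k ^ r := by
  have hr0 : 0 < r := by linarith
  have hb : 0 < α / r := by positivity
  obtain ⟨S1, hS1, h1⟩ := kernel_sum_up hb hc1 hq1
  obtain ⟨S2, hS2, h2⟩ := kernel_sum_down hb hc1 hq2
  have hℓp := lac_pos hq1 hℓ0 hℓ
  have hξp := lac_pos hq2 hξ0 hξ
  refine ⟨(S1 + S2) ^ r, by positivity, fun D hD K l => ?_⟩
  have := schur_finite hr (show 0 ≤ S1 + S2 by positivity) K l (fun k => ℓ k ^ (-(α / r)) * D k)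
    (fun k j => (ℓ k / ξ j) ^ (α / r) * Real.exp (-(c1 * (ℓ k / ξ j))))
    (fun k => mul_nonneg (Real.rpow_nonneg (hℓp k).le _) (hD k))
    (fun k j => by have := hℓp k; have := hξp j; positivity)
    (fun j => by
      refine le_trans (le_of_eq ?_) ((h1 ℓ hℓ0 hℓ (ξ j)⁻¹ (inv_pos.2 (hξp j)) K).trans (by linarith))
      simp only [div_eq_mul_inv])
    (fun k => (h2 ξ hξ0 hξ (ℓ k) (hℓp k) l).trans (by linarith))
  refine le_trans (le_of_eq ?_) (this.trans (le_of_eq ?_))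
  · apply Finset.sum_congr rfl
    intro j _
    have hj := hξp j
    have e1 : ξ j ^ (-α) = (ξ j ^ (-(α / r))) ^ r := by
      rw [← Real.rpow_mul hj.le]; congr 1; field_simp
    rw [e1, ← Real.mul_rpow (by positivity) (GG_nonneg hD)]
    congr 1
    unfold GG
    rw [Finset.mul_sum]
    apply Finset.sum_congr rfl
    intro k _
    have hk := hℓp k
    rw [Real.div_rpow hk.le hj.le, Real.rpow_neg hk.le, Real.rpow_neg hj.le]
    field_simp
  · congr 1
    apply Finset.sum_congr rfl
    intro k _
    have hk := hℓp k
    rw [Real.mul_rpow (by positivity) (hD k), ← Real.rpow_mul hk.le]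
    congr 2; field_simp

theorem condA_term {ξ α β : ℝ} (hξ : 0 < ξ) (hβ : β < 1) (I : ENNReal) :
    ENNReal.ofReal (ξ ^ (α * β / (1 - β))) * I ^ (1 / (1 - β)) =
      (ENNReal.ofReal (ξ ^ (α * β)) * I) ^ (1 / (1 - β)) := by
  have : 0 < 1 - β := by linarith
  rw [ENNReal.mul_rpow_of_nonneg _ _ (by positivity), ENNReal.ofReal_rpow_of_pos (by positivity),
    ← Real.rpow_mul hξ.le]
  congr 3; field_simp

theorem condA_singleton {Λ : ℕ → ℝ} {n : ℕ → ℕ} {N : ℕ} {α β p : ℝ} (h : IsQuasiLacunary Λ n N)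
    (hα : 0 < α) (hβ0 : 0 < β) (hβ1 : β < 1) {μ : Measure ℝ} (hA : CondA Λ n α β p μ) : μ {1} = 0 := by
  by_contra hne
  unfold CondA at hA
  have h1 : 0 < 1 - β := by linarith
  have hle : ∀ k, ENNReal.ofReal (Λ 0 ^ (α * β / (1 - β))) * μ {1} ^ (1 / (1 - β)) ≤
      ENNReal.ofReal (Λ (n k) ^ (α * β / (1 - β))) *
      (∫⁻ t in Set.Icc (0:ℝ) 1, ENNReal.ofReal (t ^ (p * Λ (n k))) ∂μ) ^ (1 / (1 - β)) := by
    intro k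
    have a1 : Λ 0 ^ (α * β / (1 - β)) ≤ Λ (n k) ^ (α * β / (1 - β)) :=
      Real.rpow_le_rpow (h.pos 0).le (h.mono.monotone (Nat.zero_le _)) (by positivity)
    have a2 : μ {1} ≤ ∫⁻ t in Set.Icc (0:ℝ) 1, ENNReal.ofReal (t ^ (p * Λ (n k))) ∂μ := by
      calc μ {1} = ∫⁻ t in {(1:ℝ)}, ENNReal.ofReal (t ^ (p * Λ (n k))) ∂μ := by
            rw [lintegral_singleton]; simp
        _ ≤ _ := lintegral_mono_set (by simp)
    gcongr
  have h2 : ∑' _ : ℕ, ENNReal.ofReal (Λ 0 ^ (α * β / (1 - β))) * μ {1} ^ (1 / (1 - β)) = ⊤ := by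
    apply ENNReal.tsum_const_eq_top_of_ne_zero
    have hL := h.pos 0
    apply mul_ne_zero
    · simp only [ne_eq, ENNReal.ofReal_eq_zero, not_le]; positivity
    · simp only [ne_eq, ENNReal.rpow_eq_zero_iff, not_or, not_and]
      exact ⟨fun hh => absurd hh hne, fun _ => by rw [not_lt]; positivity⟩
  have h3 := ENNReal.tsum_le_tsum hle
  rw [h2] at h3
  exact absurd (lt_of_le_of_lt h3 hA) (lt_irrefl _)

theorem suff_core {Λ : ℕ → ℝ} {n : ℕ → ℕ} {N : ℕ} {α β p : ℝ}
    (hQL : IsQuasiLacunary Λ n N) (hsubg : IsSubgeometric Λ n)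
    (hα : 0 < α) (hβ0 : 0 < β) (hβ1 : β < 1) (hp : 1 ≤ p)
    {μ : Measure ℝ} (hμ : μ (Set.Icc (0:ℝ) 1)ᶜ = 0) (hA : CondA Λ n α β p μ) :
    ∃ C : ENNReal, C ≠ ⊤ ∧ ∀ K a, ∫⁻ t, ‖mP Λ K a t‖ₑ ^ p ∂μ ≤
      C * (∫⁻ t, ‖mP Λ K a t‖ₑ ^ (p / β) ∂(nuMeas α)) ^ β := by
  have hp0 : 0 < p := by linarith
  set r := p / β with hrdef
  have hr0 : 0 < r := by positivity
  have hr : 1 ≤ r := by rw [hrdef, le_div_iff₀ hβ0]; linarith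
  have hmu1 := condA_singleton hQL hα hβ0 hβ1 hA
  obtain ⟨ℓ, q1, C, c1, hℓ0, hq1, hC, hc1, hℓ, hpt⟩ := pointwise_bound hQL hsubg (show 0 < 1 / r by positivity)
  obtain ⟨q2, hq2, hξ⟩ := xi_lac hQL
  obtain ⟨Q, hQ, hub⟩ := xi_ub hQL hsubg
  obtain ⟨C2, hC2, hlb⟩ := lower_bound hα hr hq1 hℓ0 hℓ
  set ξ : ℕ → ℝ := fun k => Λ (n k) with hξdef
  have hξp : ∀ k, 0 < ξ k := fun k => hQL.pos _
  have hξ00 : ξ 0 = Λ 0 := by rw [hξdef]; simp [hQL.n_zero]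
  have hξT : Tendsto ξ atTop atTop := (ql_tendsto hQL).comp hQL.n_mono.tendsto_atTop
  obtain ⟨C3, hC3, hschur⟩ := GG_schur hα hr hc1 hq1 hq2 hℓ0 (hξp 0) hℓ hξ
  have hℓp := lac_pos hq1 hℓ0 hℓ
  set I : ℕ → ENNReal := fun k => ∫⁻ t in Set.Icc (0:ℝ) 1, ENNReal.ofReal (t ^ (p * ξ k)) ∂μ with hI
  have hres : μ.restrict (Icc (0:ℝ) 1) = μ := Measure.restrict_eq_self_of_ae_mem (by
    rw [ae_iff]; exact hμ)
  set A := ∑' k, (ENNReal.ofReal (ξ k ^ (α * β)) * I k) ^ (1 / (1 - β)) with hAdef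
  have hAtop : A < ⊤ := by
    rw [hAdef]
    refine lt_of_le_of_lt (le_of_eq ?_) hA
    apply tsum_congr
    intro k
    rw [← condA_term (hξp k) hβ1]
  have h1β : 0 < 1 - β := by linarith
  refine ⟨ENNReal.ofReal ((C * Real.exp Q) ^ p) * ((ENNReal.ofReal (C3 * C2)) ^ β * A ^ (1 - β)), ?_, ?_⟩
  · refine ENNReal.mul_ne_top ENNReal.ofReal_ne_top (ENNReal.mul_ne_top ?_ ?_)
    · exact ENNReal.rpow_ne_top_of_nonneg hβ0.le ENNReal.ofReal_ne_top
    · exact ENNReal.rpow_ne_top_of_nonneg h1β.le hAtop.ne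
  intro K a
  set D : ℕ → ℝ := fun k => DK (ℓ k) (eP (fun j => Λ j + 1 / r) K a) with hDdef
  have hD : ∀ k, 0 ≤ D k := fun k => DK_nonneg (hℓp k) _
  set G : ℕ → ℝ := fun j => GG D ℓ c1 K (ξ j) with hG
  have hG0 : ∀ j, 0 ≤ G j := fun j => GG_nonneg hD
  have hmeas : ∀ j, Measurable fun t : ℝ => ENNReal.ofReal (G j ^ p) * ENNReal.ofReal (t ^ (p * ξ j)) := by
    intro j; fun_prop
  have step1 : ∫⁻ t, ‖mP Λ K a t‖ₑ ^ p ∂μ ≤ ENNReal.ofReal ((C * Real.exp Q) ^ p) *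
      ∑' j, ENNReal.ofReal (G j ^ p) * I j := by
    have : ∑' j, ENNReal.ofReal (G j ^ p) * I j =
        ∫⁻ t, ∑' j, ENNReal.ofReal (G j ^ p) * ENNReal.ofReal (t ^ (p * ξ j)) ∂μ := by
      rw [lintegral_tsum (fun j => (hmeas j).aemeasurable)]
      apply tsum_congr
      intro j
      rw [lintegral_const_mul' _ _ ENNReal.ofReal_ne_top, hI]
      simp only [hres]
    rw [this, ← lintegral_const_mul' _ _ ENNReal.ofReal_ne_top]
    apply lintegral_mono_ae
    have ae1 : ∀ᵐ t ∂μ, t ∈ Icc (0:ℝ) 1 := by rw [ae_iff]; exact hμ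
    have ae2 : ∀ᵐ t ∂μ, t ≠ 1 := by rw [ae_iff]; simpa using hmu1
    filter_upwards [ae1, ae2] with t ht ht1
    rcases ht.1.eq_or_lt with h0 | h0
    · have : mP Λ K a t = 0 := by
        unfold mP
        apply Finset.sum_eq_zero
        intro j _
        rw [← h0, Real.zero_rpow (hQL.pos j).ne']; simp
      rw [this, enorm_zero, ENNReal.zero_rpow_of_pos hp0]
      exact bot_le
    · have hs : 0 < -Real.log t := by
        have := Real.log_neg h0 (lt_of_le_of_ne ht.2 ht1); linarith
      set s := -Real.log t with hsdef
      have hts : t = Real.exp (-s) := by rw [hsdef, neg_neg, Real.exp_log h0]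
      obtain ⟨j, hj⟩ := majorant (K := K) hD hℓp hc1 hξp hξT hQ hub hs
      have hb := hpt K a s hs.le
      have hb2 : ‖mP Λ K a t‖ ≤ C * Real.exp Q * (G j * t ^ ξ j) := by
        rw [hts, mP_exp]
        refine hb.trans ?_
        rw [← hξ00, mul_assoc]
        apply mul_le_mul_of_nonneg_left _ hC.le
        refine hj.trans (le_of_eq ?_)
        rw [← Real.exp_mul]; congr 3; ring
      have hb3 : ‖mP Λ K a t‖ₑ ^ p ≤ ENNReal.ofReal ((C * Real.exp Q) ^ p) *
          (ENNReal.ofReal (G j ^ p) * ENNReal.ofReal (t ^ (p * ξ j))) := by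
        have := hG0 j
        rw [← ofReal_norm, ENNReal.ofReal_rpow_of_nonneg (norm_nonneg _) hp0.le,
          ← ENNReal.ofReal_mul (by positivity), ← ENNReal.ofReal_mul (by positivity)]
        apply ENNReal.ofReal_le_ofReal
        refine (Real.rpow_le_rpow (norm_nonneg _) hb2 hp0.le).trans (le_of_eq ?_)
        rw [Real.mul_rpow (by positivity) (by positivity), Real.mul_rpow this (by positivity),
          ← Real.rpow_mul h0.le, mul_comm p]
      refine hb3.trans ?_
      gcongr
      exact ENNReal.le_tsum (f := fun j => ENNReal.ofReal (G j ^ p) * ENNReal.ofReal (t ^ (p * ξ j))) j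
  have step2 : ∑' j, ENNReal.ofReal (G j ^ p) * I j ≤
      (∑' j, ENNReal.ofReal (ξ j ^ (-α) * G j ^ r)) ^ β * A ^ (1 - β) := by
    have hconj : (1 / β).HolderConjugate (1 / (1 - β)) := by
      rw [Real.holderConjugate_iff]
      constructor
      · rw [lt_div_iff₀ hβ0]; linarith
      · field_simp; ring
    have := tsum_holder hconj (fun j => ENNReal.ofReal (ξ j ^ (-(α * β)) * G j ^ p))
      (fun j => ENNReal.ofReal (ξ j ^ (α * β)) * I j)
    refine le_trans (le_of_eq ?_) (this.trans (le_of_eq ?_))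
    · apply tsum_congr
      intro j
      have h1 := hξp j
      have h2 := hG0 j
      rw [← mul_assoc, ← ENNReal.ofReal_mul (by positivity)]
      congr 2
      rw [Real.rpow_neg h1.le]; field_simp
    · rw [one_div_one_div, one_div_one_div]
      congr 2
      apply tsum_congr
      intro j
      have h1 := hξp j
      have h2 := hG0 j
      rw [ENNReal.ofReal_rpow_of_nonneg (by positivity) (by positivity),
        Real.mul_rpow (by positivity) (by positivity), ← Real.rpow_mul h1.le, ← Real.rpow_mul h2]
      congr 3
      · field_simp
      · rw [hrdef]; field_simp
  have step3 : ∑' j, ENNReal.ofReal (ξ j ^ (-α) * G j ^ r) ≤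
      ENNReal.ofReal (C3 * C2) * ∫⁻ t, ‖mP Λ K a t‖ₑ ^ r ∂(nuMeas α) := by
    apply ENNReal.tsum_le_of_sum_range_le
    intro l
    rw [← ENNReal.ofReal_sum_of_nonneg (fun j _ => by have := hξp j; have := hG0 j; positivity)]
    refine (ENNReal.ofReal_le_ofReal (hschur D hD K l)).trans ?_
    rw [ENNReal.ofReal_mul hC3.le, ENNReal.ofReal_mul hC3.le, mul_assoc]
    gcongr
    refine le_trans (le_of_eq ?_) (hlb Λ K a K)
    rw [ENNReal.ofReal_sum_of_nonneg (fun j _ => by have := hℓp j; have := hD j; positivity)]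
    apply Finset.sum_congr rfl
    intro k _
    have := hℓp k
    rw [ENNReal.ofReal_mul (by positivity), ENNReal.ofReal_rpow_of_nonneg (hD k) hr0.le]
  calc _ ≤ _ := step1
    _ ≤ ENNReal.ofReal ((C * Real.exp Q) ^ p) * ((ENNReal.ofReal (C3 * C2) * ∫⁻ t, ‖mP Λ K a t‖ₑ ^ r ∂(nuMeas α)) ^ β * A ^ (1 - β)) := by
        gcongr
        refine step2.trans ?_
        gcongr
    _ = _ := by
        rw [ENNReal.mul_rpow_of_nonneg _ _ hβ0.le]; ring

theorem suff_dir {Λ : ℕ → ℝ} {n : ℕ → ℕ} {N : ℕ} {α β p : ℝ}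
    (hQL : IsQuasiLacunary Λ n N) (hsubg : IsSubgeometric Λ n)
    (hα : 0 < α) (hβ0 : 0 < β) (hβ1 : β < 1) (hp : 1 ≤ p)
    {μ : Measure ℝ} (hμ : μ (Set.Icc (0:ℝ) 1)ᶜ = 0) (hA : CondA Λ n α β p μ) :
    ∃ C : ℝ, 0 < C ∧ ∀ f ∈ MuntzPoly Λ,
        MeasureTheory.eLpNorm f (ENNReal.ofReal p) μ ≤
          ENNReal.ofReal C *
            MeasureTheory.eLpNorm f (ENNReal.ofReal (p / β)) (nuMeas α) := by
  obtain ⟨C, hC, hb⟩ := suff_core hQL hsubg hα hβ0 hβ1 hp hμ hA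
  have hp0 : 0 < p := by linarith
  have hr0 : 0 < p / β := by positivity
  refine ⟨(C ^ (1 / p)).toReal + 1, by positivity, ?_⟩
  rintro f ⟨K, a, rfl⟩
  have h1 := hb (K + 1) a
  change eLpNorm (mP Λ (K + 1) a) _ _ ≤ _ * eLpNorm (mP Λ (K + 1) a) _ _
  rw [eLpNorm_eq_lintegral_rpow_enorm_toReal (by simpa using hp0) ENNReal.ofReal_ne_top,
    eLpNorm_eq_lintegral_rpow_enorm_toReal (by simpa using hr0) ENNReal.ofReal_ne_top,
    ENNReal.toReal_ofReal hp0.le, ENNReal.toReal_ofReal hr0.le]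
  have hCt : C ^ (1 / p) ≠ ⊤ := ENNReal.rpow_ne_top_of_nonneg (by positivity) hC
  have h2 : C ^ (1 / p) ≤ ENNReal.ofReal ((C ^ (1 / p)).toReal + 1) := by
    rw [← ENNReal.ofReal_toReal hCt]
    apply ENNReal.ofReal_le_ofReal
    rw [ENNReal.toReal_ofReal ENNReal.toReal_nonneg]; linarith
  calc _ ≤ (C * (∫⁻ t, ‖mP Λ (K + 1) a t‖ₑ ^ (p / β) ∂(nuMeas α)) ^ β) ^ (1 / p) := by gcongr
    _ = C ^ (1 / p) * (∫⁻ t, ‖mP Λ (K + 1) a t‖ₑ ^ (p / β) ∂(nuMeas α)) ^ (1 / (p / β)) := by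
        rw [ENNReal.mul_rpow_of_nonneg _ _ (by positivity), ← ENNReal.rpow_mul]
        congr 2; field_simp
    _ ≤ _ := by gcongr

/-- coefficients of the test polynomial -/
noncomputable def tc (n : ℕ → ℕ) (m : ℕ) (b : ℕ → ℝ) (j : ℕ) : ℂ :=
  ∑ k ∈ Finset.range m, if n k = j then (b k : ℂ) else 0

theorem mP_tc {Λ : ℕ → ℝ} {n : ℕ → ℕ} (hn : StrictMono n) (m : ℕ) (b : ℕ → ℝ) (t : ℝ) :
    mP Λ (n m + 1) (tc n m b) t = ((∑ k ∈ Finset.range m, b k * t ^ Λ (n k) : ℝ) : ℂ) := by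
  unfold mP tc
  simp_rw [Finset.sum_mul]
  rw [Finset.sum_comm]
  push_cast
  apply Finset.sum_congr rfl
  intro k hk
  have hkm : n k < n m + 1 := by
    have := hn (Finset.mem_range.1 hk); omega
  rw [Finset.sum_eq_single (n k)]
  · simp
  · intro j _ hj
    rw [if_neg (Ne.symm hj), zero_mul]
  · intro hh
    exact absurd (Finset.mem_range.2 hkm) hh

theorem sum_rpow_le_rpow_sum' {p : ℝ} (hp : 1 ≤ p) (x : ℕ → ENNReal) (m : ℕ) :
    ∑ k ∈ Finset.range m, x k ^ p ≤ (∑ k ∈ Finset.range m, x k) ^ p := by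
  induction m with
  | zero => simp
  | succ m ih =>
    rw [Finset.sum_range_succ, Finset.sum_range_succ]
    exact (add_le_add_left ih _).trans (ENNReal.add_rpow_le_rpow_add _ _ hp)

theorem test_lower {Λ : ℕ → ℝ} {n : ℕ → ℕ} (hn : StrictMono n) {p : ℝ} (hp : 1 ≤ p)
    (μ : Measure ℝ) (hμ : μ (Set.Icc (0:ℝ) 1)ᶜ = 0) (m : ℕ) (b : ℕ → ℝ) (hb : ∀ k, 0 ≤ b k) :
    ∑ k ∈ Finset.range m, ENNReal.ofReal (b k ^ p) *
      ∫⁻ t in Set.Icc (0:ℝ) 1, ENNReal.ofReal (t ^ (p * Λ (n k))) ∂μ ≤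
      ∫⁻ t, ‖mP Λ (n m + 1) (tc n m b) t‖ₑ ^ p ∂μ := by
  have hp0 : 0 < p := by linarith
  have hres : μ.restrict (Icc (0:ℝ) 1) = μ := Measure.restrict_eq_self_of_ae_mem (by
    rw [ae_iff]; exact hμ)
  simp_rw [hres]
  simp_rw [← lintegral_const_mul' _ _ ENNReal.ofReal_ne_top]
  rw [← lintegral_finsetSum _ (fun k _ => by fun_prop)]
  apply lintegral_mono_ae
  have ae1 : ∀ᵐ t ∂μ, t ∈ Icc (0:ℝ) 1 := by rw [ae_iff]; exact hμ
  filter_upwards [ae1] with t ht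
  have ht0 : 0 ≤ t := ht.1
  rw [mP_tc hn, ← ofReal_norm, Complex.norm_real, Real.norm_of_nonneg
    (Finset.sum_nonneg fun k _ => mul_nonneg (hb k) (Real.rpow_nonneg ht0 _)),
    ENNReal.ofReal_sum_of_nonneg (fun k _ => mul_nonneg (hb k) (Real.rpow_nonneg ht0 _))]
  refine le_trans (le_of_eq ?_) (sum_rpow_le_rpow_sum' hp _ m)
  apply Finset.sum_congr rfl
  intro k _
  have := hb k
  rw [ENNReal.ofReal_rpow_of_nonneg (by positivity) hp0.le, ← ENNReal.ofReal_mul (by positivity),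
    Real.mul_rpow this (by positivity), ← Real.rpow_mul ht0, mul_comm p]

theorem gamma_lint {a x : ℝ} (ha : 0 < a) (hx : 0 < x) :
    ∫⁻ s in Ioi (0:ℝ), ENNReal.ofReal (s⁻¹ * ((x * s) ^ a * Real.exp (-(x * s)))) =
      ENNReal.ofReal (Real.Gamma a) := by
  have h := Real.integral_rpow_mul_exp_neg_mul_Ioi ha hx
  have hG := Real.Gamma_pos_of_pos ha
  have hInt : IntegrableOn (fun t : ℝ => t ^ (a - 1) * Real.exp (-(x * t))) (Ioi 0) := by
    by_contra hc
    rw [integral_undef hc] at h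
    have : 0 < (1 / x) ^ a * Real.Gamma a := by positivity
    linarith
  have hE : ∀ s ∈ Ioi (0:ℝ), ENNReal.ofReal (s⁻¹ * ((x * s) ^ a * Real.exp (-(x * s)))) =
      ENNReal.ofReal (x ^ a * (s ^ (a - 1) * Real.exp (-(x * s)))) := by
    intro s hs
    have hs0 : 0 < s := hs
    congr 1
    rw [Real.mul_rpow hx.le hs0.le, Real.rpow_sub_one hs0.ne']
    field_simp
  rw [setLIntegral_congr_fun measurableSet_Ioi hE,
    ← ofReal_integral_eq_lintegral_ofReal (hInt.const_mul _)]
  · rw [integral_const_mul, h, ← mul_assoc, ← Real.mul_rpow hx.le (by positivity)]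
    rw [mul_one_div_cancel hx.ne', Real.one_rpow, one_mul]
  · rw [EventuallyLE, ae_restrict_iff' measurableSet_Ioi]
    filter_upwards with s hs
    have hs0 : 0 < s := hs
    simp only [Pi.zero_apply]; positivity

theorem test_upper {Λ : ℕ → ℝ} {n : ℕ → ℕ} {N : ℕ} {α r : ℝ} (hQL : IsQuasiLacunary Λ n N)
    (hα : 0 < α) (hr : 1 ≤ r) : ∃ C, 0 < C ∧ ∀ (m : ℕ) (b : ℕ → ℝ), (∀ k, 0 ≤ b k) →
    ∫⁻ t, ‖mP Λ (n m + 1) (tc n m b) t‖ₑ ^ r ∂(nuMeas α) ≤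
      ENNReal.ofReal (C * ∑ k ∈ Finset.range m, b k ^ r * Λ (n k) ^ (-α)) := by
  have hr0 : 0 < r := by linarith
  obtain ⟨q2, hq2, hξ⟩ := xi_lac hQL
  have ha : 0 < α / r := by positivity
  set c := α / r with hc
  obtain ⟨S, hS, hk⟩ := kernel_sum_up ha one_pos hq2
  have hG := Real.Gamma_pos_of_pos ha
  refine ⟨S ^ (r - 1) * Real.Gamma c, by positivity, fun m b hb => ?_⟩
  have hξp : ∀ k, 0 < Λ (n k) := fun k => hQL.pos _
  rw [nu_cov α ((mP_measurable _ _ _).enorm.pow_const r)]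
  have hpt : ∀ s ∈ Ioi (0:ℝ), ENNReal.ofReal ((1 - Real.exp (-s)) ^ (α - 1) * Real.exp (-s)) *
      ‖mP Λ (n m + 1) (tc n m b) (Real.exp (-s))‖ₑ ^ r ≤
      ∑ k ∈ Finset.range m, ENNReal.ofReal (S ^ (r - 1) * (b k ^ r * Λ (n k) ^ (-α))) *
        ENNReal.ofReal (s⁻¹ * ((Λ (n k) * s) ^ c * Real.exp (-(Λ (n k) * s)))) := by
    intro s hs
    have hs0 : 0 < s := hs
    set ψ : ℕ → ℝ := fun k => (Λ (n k) * s) ^ c * Real.exp (-(Λ (n k) * s)) with hψ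
    have hψ0 : ∀ k, 0 ≤ ψ k := fun k => by have := hξp k; rw [hψ]; positivity
    set x : ℕ → ℝ := fun k => b k * Λ (n k) ^ (-c) with hx
    have hx0 : ∀ k, 0 ≤ x k := fun k => mul_nonneg (hb k) (Real.rpow_nonneg (hξp k).le _)
    have hsum : ∑ k ∈ Finset.range m, ψ k ≤ S := by
      have := hk (fun k => Λ (n k)) (hξp 0) hξ s hs0 m
      simpa using this
    have hw := Real.inner_le_weight_mul_Lp_of_nonneg (Finset.range m) hr ψ x hψ0 hx0
    have hs0' : 0 ≤ ∑ k ∈ Finset.range m, ψ k := Finset.sum_nonneg fun k _ => hψ0 k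
    have hs1 : 0 ≤ ∑ k ∈ Finset.range m, ψ k * x k ^ r :=
      Finset.sum_nonneg fun k _ => mul_nonneg (hψ0 k) (Real.rpow_nonneg (hx0 k) _)
    have hs2 : 0 ≤ ∑ k ∈ Finset.range m, ψ k * x k :=
      Finset.sum_nonneg fun k _ => mul_nonneg (hψ0 k) (hx0 k)
    have hle : (∑ k ∈ Finset.range m, ψ k * x k) ^ r ≤ S ^ (r - 1) * ∑ k ∈ Finset.range m, ψ k * x k ^ r := by
      calc _ ≤ ((∑ k ∈ Finset.range m, ψ k) ^ (1 - r⁻¹) * (∑ k ∈ Finset.range m, ψ k * x k ^ r) ^ r⁻¹) ^ r :=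
            Real.rpow_le_rpow hs2 hw hr0.le
        _ = (∑ k ∈ Finset.range m, ψ k) ^ (r - 1) * (∑ k ∈ Finset.range m, ψ k * x k ^ r) := by
            rw [Real.mul_rpow (by positivity) (by positivity), ← Real.rpow_mul hs0', ← Real.rpow_mul hs1,
              inv_mul_cancel₀ hr0.ne', Real.rpow_one]
            congr 2; field_simp
        _ ≤ _ := mul_le_mul_of_nonneg_right (Real.rpow_le_rpow hs0' hsum (by linarith)) hs1
    have hnorm : ‖mP Λ (n m + 1) (tc n m b) (Real.exp (-s))‖ₑ = ENNReal.ofReal (s ^ (-c) * ∑ k ∈ Finset.range m, ψ k * x k) := by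
      rw [mP_tc hQL.n_mono, ← ofReal_norm, Complex.norm_real, Real.norm_of_nonneg
        (Finset.sum_nonneg fun k _ => mul_nonneg (hb k) (by positivity))]
      congr 1
      rw [Finset.mul_sum]
      apply Finset.sum_congr rfl
      intro k _
      have h1 := hξp k
      simp only [hψ, hx]
      rw [← Real.exp_mul, Real.mul_rpow h1.le hs0.le, Real.rpow_neg h1.le, Real.rpow_neg hs0.le]
      have : -s * Λ (n k) = -(Λ (n k) * s) := by ring
      rw [this]
      field_simp
    have hwt : 0 ≤ (1 - Real.exp (-s)) ^ (α - 1) * Real.exp (-s) := by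
      have h1 : Real.exp (-s) < 1 := by rw [Real.exp_lt_one_iff]; linarith
      have : 0 ≤ (1 - Real.exp (-s)) ^ (α - 1) := Real.rpow_nonneg (by linarith) _
      positivity
    have hterm : ∀ k, 0 ≤ S ^ (r - 1) * (b k ^ r * Λ (n k) ^ (-α)) := fun k => by
      have := hξp k; have := hb k; positivity
    simp_rw [fun k => (ENNReal.ofReal_mul (hterm k) (q := s⁻¹ * ((Λ (n k) * s) ^ c * Real.exp (-(Λ (n k) * s))))).symm]
    rw [hnorm, ENNReal.ofReal_rpow_of_nonneg (by positivity) hr0.le, ← ENNReal.ofReal_mul hwt,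
      ← ENNReal.ofReal_sum_of_nonneg (fun k _ => mul_nonneg (hterm k) (mul_nonneg (by positivity) (hψ0 k)))]
    apply ENNReal.ofReal_le_ofReal
    calc _ ≤ s ^ (α - 1) * (s ^ (-c) * ∑ k ∈ Finset.range m, ψ k * x k) ^ r :=
          mul_le_mul_of_nonneg_right (nu_weight_le hα hs0) (by positivity)
      _ = s⁻¹ * (∑ k ∈ Finset.range m, ψ k * x k) ^ r := by
          rw [Real.mul_rpow (by positivity) hs2, ← Real.rpow_mul hs0.le, ← mul_assoc, ← Real.rpow_add hs0]
          have : α - 1 + -c * r = -1 := by rw [hc]; field_simp; ring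
          rw [this, Real.rpow_neg_one]
      _ ≤ s⁻¹ * (S ^ (r - 1) * ∑ k ∈ Finset.range m, ψ k * x k ^ r) := by gcongr
      _ = _ := by
          rw [Finset.mul_sum, Finset.mul_sum]
          apply Finset.sum_congr rfl
          intro k _
          have h1 := hξp k
          have : x k ^ r = b k ^ r * Λ (n k) ^ (-α) := by
            simp only [hx]
            rw [Real.mul_rpow (hb k) (by positivity), ← Real.rpow_mul h1.le]
            congr 2; rw [hc]; field_simp
          rw [this]; simp only [hψ]; ring
  refine (setLIntegral_mono' measurableSet_Ioi hpt).trans (le_of_eq ?_)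
  rw [lintegral_finsetSum _ (fun k _ => by fun_prop)]
  simp_rw [lintegral_const_mul' _ _ ENNReal.ofReal_ne_top]
  simp_rw [fun k => gamma_lint ha (hξp k)]
  simp_rw [← ENNReal.ofReal_mul' hG.le]
  rw [← ENNReal.ofReal_sum_of_nonneg (fun k _ => by have := hξp k; have := hb k; positivity)]
  congr 1
  rw [Finset.mul_sum]
  apply Finset.sum_congr rfl
  intro k _
  ring

theorem nec_dir {Λ : ℕ → ℝ} {n : ℕ → ℕ} {N : ℕ} {α β p : ℝ}
    (hQL : IsQuasiLacunary Λ n N)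
    (hα : 0 < α) (hβ0 : 0 < β) (hβ1 : β < 1) (hp : 1 ≤ p)
    {μ : Measure ℝ} (hμ : μ (Set.Icc (0:ℝ) 1)ᶜ = 0)
    (hE : ∃ C : ℝ, 0 < C ∧ ∀ f ∈ MuntzPoly Λ,
        MeasureTheory.eLpNorm f (ENNReal.ofReal p) μ ≤
          ENNReal.ofReal C *
            MeasureTheory.eLpNorm f (ENNReal.ofReal (p / β)) (nuMeas α)) : CondA Λ n α β p μ := by
  obtain ⟨C0, hC0, hE⟩ := hE
  have hp0 : 0 < p := by linarith
  set r := p / β with hrdef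
  have hr0 : 0 < r := by positivity
  have hr : 1 ≤ r := by rw [hrdef, le_div_iff₀ hβ0]; linarith
  have h1β : 0 < 1 - β := by linarith
  obtain ⟨C, hC, hup⟩ := test_upper hQL hα hr
  have hξp : ∀ k, 0 < Λ (n k) := fun k => hQL.pos _
  set I : ℕ → ENNReal := fun k => ∫⁻ t in Set.Icc (0:ℝ) 1, ENNReal.ofReal (t ^ (p * Λ (n k))) ∂μ with hI
  set C1 := C0 ^ p * C ^ β with hC1
  have hC1p : 0 < C1 := by positivity
  have key : ∀ (m : ℕ) (b : ℕ → ℝ), (∀ k, 0 ≤ b k) →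
      ∑ k ∈ Finset.range m, ENNReal.ofReal (b k ^ p) * I k ≤
        ENNReal.ofReal (C1 * (∑ k ∈ Finset.range m, b k ^ r * Λ (n k) ^ (-α)) ^ β) := by
    intro m b hb
    have h1 := hE (mP Λ (n m + 1) (tc n m b)) ⟨n m, tc n m b, rfl⟩
    rw [eLpNorm_eq_lintegral_rpow_enorm_toReal (by simpa using hp0) ENNReal.ofReal_ne_top,
      eLpNorm_eq_lintegral_rpow_enorm_toReal (by simpa using hr0) ENNReal.ofReal_ne_top,
      ENNReal.toReal_ofReal hp0.le, ENNReal.toReal_ofReal hr0.le] at h1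
    have hB : 0 ≤ ∑ k ∈ Finset.range m, b k ^ r * Λ (n k) ^ (-α) :=
      Finset.sum_nonneg fun k _ => by have := hξp k; have := hb k; positivity
    refine (test_lower hQL.n_mono hp μ hμ m b hb).trans ?_
    have h2 := ENNReal.rpow_le_rpow h1 hp0.le
    rw [← ENNReal.rpow_mul, one_div_mul_cancel hp0.ne', ENNReal.rpow_one] at h2
    refine h2.trans ?_
    have h3 := hup m b hb
    calc _ ≤ (ENNReal.ofReal C0 * ENNReal.ofReal (C * ∑ k ∈ Finset.range m, b k ^ r * Λ (n k) ^ (-α)) ^ (1 / r)) ^ p := by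
          gcongr
      _ = _ := by
          rw [ENNReal.ofReal_rpow_of_nonneg (by positivity) (by positivity),
            ← ENNReal.ofReal_mul hC0.le, ENNReal.ofReal_rpow_of_nonneg (by positivity) hp0.le]
          congr 1
          rw [Real.mul_rpow hC0.le (by positivity), ← Real.rpow_mul (by positivity)]
          have : 1 / r * p = β := by rw [hrdef]; field_simp
          rw [this, Real.mul_rpow hC.le hB, hC1]; ring
  have hfin : ∀ k, I k ≠ ⊤ := by
    intro k
    have h1 := key (k + 1) (fun j => if j = k then 1 else 0) (fun j => by split_ifs <;> norm_num)
    have h2 : I k ≤ ∑ j ∈ Finset.range (k + 1), ENNReal.ofReal ((if j = k then (1:ℝ) else 0) ^ p) * I j := by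
      refine le_trans (le_of_eq ?_) (Finset.single_le_sum (f := fun j => ENNReal.ofReal ((if j = k then (1:ℝ) else 0) ^ p) * I j)
        (fun _ _ => bot_le) (Finset.self_mem_range_succ k))
      simp
    exact ne_top_of_le_ne_top ENNReal.ofReal_ne_top (h2.trans h1)
  set w : ℕ → ℝ := fun k => Λ (n k) ^ (α * β) * (I k).toReal with hw
  have hw0 : ∀ k, 0 ≤ w k := fun k => mul_nonneg (Real.rpow_nonneg (hξp k).le _) ENNReal.toReal_nonneg
  have hsum : ∀ m, ∑ k ∈ Finset.range m, w k ^ (1 / (1 - β)) ≤ C1 ^ (1 / (1 - β)) := by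
    intro m
    set T := ∑ k ∈ Finset.range m, w k ^ (1 / (1 - β)) with hT
    have hT0 : 0 ≤ T := Finset.sum_nonneg fun k _ => Real.rpow_nonneg (hw0 k) _
    set y : ℕ → ℝ := fun k => Λ (n k) ^ (α * β) * w k ^ (β / (1 - β)) with hy
    have hy0 : ∀ k, 0 ≤ y k := fun k => by
      have := hξp k; have := hw0 k; rw [hy]; positivity
    have h1 := key m (fun k => y k ^ (1 / p)) (fun k => Real.rpow_nonneg (hy0 k) _)
    have e1 : ∀ k, ENNReal.ofReal ((y k ^ (1 / p)) ^ p) * I k = ENNReal.ofReal (w k ^ (1 / (1 - β))) := by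
      intro k
      have hk := hξp k
      rw [← Real.rpow_mul (hy0 k), one_div_mul_cancel hp0.ne', Real.rpow_one]
      nth_rewrite 1 [← ENNReal.ofReal_toReal (hfin k)]
      rw [← ENNReal.ofReal_mul (hy0 k)]
      congr 1
      have : 1 / (1 - β) = 1 + β / (1 - β) := by field_simp; ring
      rw [this, Real.rpow_add_of_nonneg (hw0 k) (by norm_num) (by positivity), Real.rpow_one]
      simp only [hy]
      rw [show w k = Λ (n k) ^ (α * β) * (I k).toReal from rfl]
      ring
    have e2 : ∀ k, (y k ^ (1 / p)) ^ r * Λ (n k) ^ (-α) = w k ^ (1 / (1 - β)) := by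
      intro k
      have hk := hξp k
      have : 1 / p * r = 1 / β := by rw [hrdef]; field_simp
      rw [← Real.rpow_mul (hy0 k), this]
      simp only [hy]
      rw [Real.mul_rpow (by positivity) (Real.rpow_nonneg (hw0 k) _), ← Real.rpow_mul hk.le,
        ← Real.rpow_mul (hw0 k)]
      have a1 : α * β * (1 / β) = α := by field_simp
      have a2 : β / (1 - β) * (1 / β) = 1 / (1 - β) := by field_simp
      rw [a1, a2, Real.rpow_neg hk.le]; field_simp
    simp_rw [e1, e2] at h1
    rw [← ENNReal.ofReal_sum_of_nonneg (fun k _ => Real.rpow_nonneg (hw0 k) _),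
      ENNReal.ofReal_le_ofReal_iff (by positivity)] at h1
    rcases hT0.eq_or_lt with h0 | h0
    · rw [← h0]; positivity
    · have h2 : T ^ (1 - β) ≤ C1 := by
        rw [Real.rpow_sub h0, Real.rpow_one, div_le_iff₀ (by positivity)]
        exact h1
      calc T = (T ^ (1 - β)) ^ (1 / (1 - β)) := by
            rw [← Real.rpow_mul hT0, mul_one_div_cancel h1β.ne', Real.rpow_one]
        _ ≤ _ := Real.rpow_le_rpow (by positivity) h2 (by positivity)
  unfold CondA
  refine lt_of_le_of_lt ?_ (ENNReal.ofReal_lt_top (r := C1 ^ (1 / (1 - β))))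
  apply ENNReal.tsum_le_of_sum_range_le
  intro m
  refine le_trans (le_of_eq ?_) (ENNReal.ofReal_le_ofReal (hsum m))
  rw [ENNReal.ofReal_sum_of_nonneg (fun k _ => Real.rpow_nonneg (hw0 k) _)]
  apply Finset.sum_congr rfl
  intro k _
  have hk := hξp k
  rw [condA_term hk hβ1, ← ENNReal.ofReal_rpow_of_nonneg (hw0 k) (by positivity)]
  congr 1
  simp only [hw]
  rw [ENNReal.ofReal_mul (by positivity), ENNReal.ofReal_toReal (hfin k)]

end MuntzProof

/-- for quasi-lacunary subgeometric `Λ`, `0 < β < 1`, `p ≥ 1`, the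
embedding `M_{Λ,α}^{p/β} ↪ L^p(dμ)` holds iff `μ` satisfies `A_{p,Λ}(α,β)`. -/
theorem muntz_embedding_iff_condA
    (Λ : ℕ → ℝ) (n : ℕ → ℕ) (N : ℕ) (α β p : ℝ)
    (hQL : IsQuasiLacunary Λ n N) (hsubg : IsSubgeometric Λ n)
    (hα : 0 < α) (hβ0 : 0 < β) (hβ1 : β < 1) (hp : 1 ≤ p)
    (μ : MeasureTheory.Measure ℝ) (hμ : μ (Set.Icc (0:ℝ) 1)ᶜ = 0) :
    (∃ C : ℝ, 0 < C ∧ ∀ f ∈ MuntzPoly Λ,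
        MeasureTheory.eLpNorm f (ENNReal.ofReal p) μ ≤
          ENNReal.ofReal C *
            MeasureTheory.eLpNorm f (ENNReal.ofReal (p / β)) (nuMeas α)) ↔
    CondA Λ n α β p μ := by
  exact ⟨fun h => nec_dir hQL hα hβ0 hβ1 hp hμ h,
    fun h => suff_dir hQL hsubg hα hβ0 hβ1 hp hμ h⟩
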